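/- Let G be a TLG on N vertices. Then generically in (f_ij) ∈ 𝓕^{2N−3}, the collection K of critical orbits of line configurations of the RMA system is a finite set, and each critical orbit O_p in K is nondegenerate, i.e. the Hessian of Φ at p has exactly three zero eigenvalues. -/

import Mathlib

open Set Filter Topology MeasureTheory Matrix Function

attribute [local instance] Classical.propDecidable

noncomputable section

/-- `f̃(d) = d * f(d)`. -/
def tildeFn (f : ℝ → ℝ) : ℝ → ℝ := fun d => d * f d

/-- Membership in the class `𝓕` of monotone interaction laws:
`f` is `C¹` on `ℝ₊ = (0,∞)`, `f̃′ > 0` on `ℝ₊`, `f̃` has a zero, and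
`∫_d^1 f̃(x) dx → −∞` as `d → 0⁺`. -/
def MemF (f : ℝ → ℝ) : Prop :=
  ContDiffOn ℝ 1 f (Set.Ioi 0) ∧
  (∀ d > (0:ℝ), 0 < deriv (tildeFn f) d) ∧
  (∃ d > (0:ℝ), tildeFn f d = 0) ∧
  Tendsto (fun d => ∫ x in d..(1:ℝ), tildeFn f x) (𝓝[>] (0:ℝ)) atBot

/-- The space `C¹(ℝ₊, ℝ)`. -/
def C1Pos : Type := {f : ℝ → ℝ // ContDiffOn ℝ 1 f (Set.Ioi 0)}

/-- The Whitney `C¹`-topology on `C¹(ℝ₊, ℝ)`, generated by the basic open sets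
`B_δ(f) = {g : |g(d) − f(d)| + |g′(d) − f′(d)| < δ(d) for all d > 0}`. -/
instance : TopologicalSpace C1Pos :=
  TopologicalSpace.generateFrom
    { S | ∃ (f : C1Pos) (δ : ℝ → ℝ), ContinuousOn δ (Set.Ioi 0) ∧ (∀ d > (0:ℝ), 0 < δ d) ∧
        S = { g : C1Pos | ∀ d > (0:ℝ), |g.1 d - f.1 d| + |deriv g.1 d - deriv f.1 d| < δ d } }

/-- The class `𝓕` as a topological space (subspace of `C¹(ℝ₊,ℝ)`). -/
def FF : Type := {f : C1Pos // MemF f.1}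

instance : TopologicalSpace FF := instTopologicalSpaceSubtype

/-- `G` is a triangulated Laman graph: there is a Henneberg-type construction order
(a relabeling `σ`) starting from the edge between the first two vertices, in which every
later vertex is joined to exactly two earlier, adjacent, vertices. -/
def IsTLG {N : ℕ} (G : SimpleGraph (Fin N)) : Prop :=
  2 ≤ N ∧
  ∃ (σ : Equiv.Perm (Fin N)) (par₁ par₂ : Fin N → Fin N),
    (∀ k : Fin N, 2 ≤ (k : ℕ) →
      ((par₁ k : ℕ) < (k : ℕ) ∧ (par₂ k : ℕ) < (k : ℕ) ∧ par₁ k ≠ par₂ k ∧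
        G.Adj (σ (par₁ k)) (σ (par₂ k)))) ∧
    (∀ i j : Fin N, G.Adj (σ i) (σ j) ↔
      (((i : ℕ) = 0 ∧ (j : ℕ) = 1) ∨ ((i : ℕ) = 1 ∧ (j : ℕ) = 0) ∨
       (2 ≤ (i : ℕ) ∧ (j = par₁ i ∨ j = par₂ i)) ∨
       (2 ≤ (j : ℕ) ∧ (i = par₁ j ∨ i = par₂ j))))

/-- Euclidean distance on `ℝ²` (coordinates `(a,b)`). -/
def dist2 (x y : ℝ × ℝ) : ℝ := Real.sqrt ((x.1 - y.1)^2 + (x.2 - y.2)^2)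

/-- `p` belongs to the configuration space `P`: no collision of adjacent agents. -/
def InConfigSpace {N : ℕ} (G : SimpleGraph (Fin N)) (p : Fin N → ℝ × ℝ) : Prop :=
  ∀ i j, G.Adj i j → p i ≠ p j

/-- `p` is an equilibrium of the RMA system `ẋᵢ = Σ_{j : (i,j) ∈ E} f_ij(d_ij)(x_j − x_i)`. -/
def IsEquilibrium {N : ℕ} (G : SimpleGraph (Fin N)) (f : Fin N → Fin N → ℝ → ℝ)
    (p : Fin N → ℝ × ℝ) : Prop :=
  ∀ i, (∑ j, if G.Adj i j then (f i j (dist2 (p i) (p j))) • (p j - p i) else (0:ℝ×ℝ)) = 0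

/-- The potential function `Φ(p) = Σ_{(i,j) ∈ E} ∫_1^{d_ij} x f_ij(x) dx`
(each edge counted once; the factor 1/2 compensates the double count over ordered pairs). -/
def potential {N : ℕ} (G : SimpleGraph (Fin N)) (f : Fin N → Fin N → ℝ → ℝ)
    (p : Fin N → ℝ × ℝ) : ℝ :=
  (1/2) * ∑ i, ∑ j, if G.Adj i j then ∫ x in (1:ℝ)..(dist2 (p i) (p j)), x * f i j x else 0

/-- Coordinate directions on the configuration space, in the order `(a₁,…,a_N,b₁,…,b_N)`. -/
def basisVec {N : ℕ} : (Fin N ⊕ Fin N) → (Fin N → ℝ × ℝ) :=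
  Sum.elim (fun i => Pi.single i ((1:ℝ), (0:ℝ))) (fun i => Pi.single i ((0:ℝ), (1:ℝ)))

/-- The Hessian matrix of `Φ` at `p` in the coordinates `(a₁,…,a_N,b₁,…,b_N)`. -/
def hessian {N : ℕ} (Φ : (Fin N → ℝ × ℝ) → ℝ) (p : Fin N → ℝ × ℝ) :
    Matrix (Fin N ⊕ Fin N) (Fin N ⊕ Fin N) ℝ :=
  Matrix.of fun u v => fderiv ℝ (fun q => fderiv ℝ Φ q (basisVec v)) p (basisVec u)

/-- The inertia `𝐧(M) = (n₊(M), n₀(M), n₋(M))` of a real symmetric matrix: the numbers of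
positive, zero, and negative eigenvalues (counted with multiplicity). -/
def inertia {m : Type*} [Fintype m] [DecidableEq m] (M : Matrix m m ℝ) : ℕ × ℕ × ℕ :=
  if h : M.IsHermitian then
    ((Finset.univ.filter fun i => 0 < h.eigenvalues i).card,
     (Finset.univ.filter fun i => h.eigenvalues i = 0).card,
     (Finset.univ.filter fun i => h.eigenvalues i < 0).card)
  else (0, 0, 0)

/-- The number `n₀(M)` of zero eigenvalues of a real symmetric matrix. -/
def n0 {m : Type*} [Fintype m] [DecidableEq m] (M : Matrix m m ℝ) : ℕ := (inertia M).2.1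

/-- The vector-valued sign function. -/
def sgn3 (x : ℝ) : ℕ × ℕ × ℕ :=
  if 0 < x then (1,0,0) else if x = 0 then (0,1,0) else (0,0,1)

/-- `q` lies in the `SE(2)`-orbit of `p` (rigid motions: rotation by `(c,s)` with
`c² + s² = 1` followed by translation by `(vx,vy)`). -/
def sameOrbit {N : ℕ} (p q : Fin N → ℝ × ℝ) : Prop :=
  ∃ c s vx vy : ℝ, c^2 + s^2 = 1 ∧
    ∀ i, q i = (c * (p i).1 - s * (p i).2 + vx, s * (p i).1 + c * (p i).2 + vy)

/-- The interaction laws determined by an ensemble `ω ∈ 𝓕^{|E|}`. -/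
def ensembleLaws {N : ℕ} {G : SimpleGraph (Fin N)} (ω : G.edgeSet → FF) :
    Fin N → Fin N → ℝ → ℝ :=
  fun i j => if h : G.Adj i j then (ω ⟨s(i,j), G.mem_edgeSet.mpr h⟩).1.1 else 0

/-- The line configuration on the `a`-axis with coordinates `a`. -/
def lineConfig {N : ℕ} (a : Fin N → ℝ) : Fin N → ℝ × ℝ := fun i => (a i, 0)

/-- The matrix `F_p` of a line configuration with coordinates `a`: symmetric, zero row sums,
off-diagonal entries `φ_ij(d_ij)` on edges and `0` otherwise. -/
def FMat {N : ℕ} (G : SimpleGraph (Fin N)) (φ : Fin N → Fin N → ℝ → ℝ)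
    (a : Fin N → ℝ) : Matrix (Fin N) (Fin N) ℝ :=
  Matrix.of fun i j =>
    if i = j then -∑ k, (if G.Adj i k then φ i k |a i - a k| else 0)
    else if G.Adj i j then φ i j |a i - a j| else 0

/-- The matrix `d̃F_p`: off-diagonal entries `f̃′_ij(d_ij)` on edges. -/
def dFMat {N : ℕ} (G : SimpleGraph (Fin N)) (f : Fin N → Fin N → ℝ → ℝ)
    (a : Fin N → ℝ) : Matrix (Fin N) (Fin N) ℝ :=
  FMat G (fun i j d => deriv (tildeFn (f i j)) d) a

/-- Case 1 balanced distance: the (generically unique) `d₁₂(d)` with `0 < d₁₂ < d` and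
`f̃₁₂(d₁₂) = f̃₁₃(d − d₁₂)`. -/
def case1d12 (f12 f13 : ℝ → ℝ) (d : ℝ) : ℝ :=
  Classical.epsilon fun t => 0 < t ∧ t < d ∧ tildeFn f12 t = tildeFn f13 (d - t)

/-- The case-1 virtual interaction: `g̃₂₃(d) = f̃₁₂(d₁₂(d))`. -/
def g23Case1 (f12 f13 : ℝ → ℝ) : ℝ → ℝ :=
  fun d => tildeFn f12 (case1d12 f12 f13 d) / d

/-- Case 2 balanced distance: the (generically unique) `d₁₂(d) > 0` with
`f̃₁₂(d₁₂) + f̃₁₃(d₁₂ + d) = 0`. -/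
def case2d12 (f12 f13 : ℝ → ℝ) (d : ℝ) : ℝ :=
  Classical.epsilon fun t => 0 < t ∧ tildeFn f12 t + tildeFn f13 (t + d) = 0

/-- The case-2 virtual interaction: `g̃₂₃(d) = f̃₁₃(d₁₃(d))`, `d₁₃(d) = d₁₂(d) + d`. -/
def g23Case2 (f12 f13 : ℝ → ℝ) : ℝ → ℝ :=
  fun d => tildeFn f13 (case2d12 f12 f13 d + d) / d

/-- The case-3 virtual interaction: case 2 with the roles of agents 2,3 (and `f₁₂`,`f₁₃`)
interchanged. -/
def g23Case3 (f12 f13 : ℝ → ℝ) : ℝ → ℝ := g23Case2 f13 f12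

/-- The virtual interaction between agents 2 and 3 induced by `f₁₂`, `f₁₃`, chosen according
to which of the three aligned agents (at coordinates `a1`, `a2`, `a3`) lies between the
other two. -/
def virtualG (f12 f13 : ℝ → ℝ) (a1 a2 a3 : ℝ) : ℝ → ℝ :=
  if (a2 < a1 ∧ a1 < a3) ∨ (a3 < a1 ∧ a1 < a2) then g23Case1 f12 f13
  else if (a1 < a2 ∧ a2 < a3) ∨ (a3 < a2 ∧ a2 < a1) then g23Case2 f12 f13
  else g23Case3 f12 f13

/-- The interaction laws of the reduced system: vertex `0` (the last Henneberg vertex,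
the paper's vertex 1) is deleted, reduced vertex `i` is original vertex `i+1`, and the law on
the reduced edge `(0,1)` (the paper's edge `(2,3)`) is `f*₂₃ = f₂₃ + g₂₃`. -/
def reducedLaws {n : ℕ} (f : Fin (n+3) → Fin (n+3) → ℝ → ℝ) (g : ℝ → ℝ) :
    Fin (n+2) → Fin (n+2) → ℝ → ℝ :=
  fun i j => if (i = 0 ∧ j = 1) ∨ (i = 1 ∧ j = 0)
    then fun d => f i.succ j.succ d + g d
    else f i.succ j.succ

end

/-- The weighted graph Laplacian with weights `w`. -/
def weightLaplacian {N : ℕ} (w : Fin N → Fin N → ℝ) : Matrix (Fin N) (Fin N) ℝ :=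
  Matrix.diagonal (fun i => ∑ j, w i j) - Matrix.of w

theorem weightLaplacian_mulVec {N : ℕ} (w : Fin N → Fin N → ℝ) (β : Fin N → ℝ) (i : Fin N) :
    (weightLaplacian w *ᵥ β) i = ∑ j, w i j * (β i - β j) := by
  rw [weightLaplacian, Matrix.sub_mulVec, Pi.sub_apply, Matrix.mulVec_diagonal]
  simp only [Matrix.mulVec, dotProduct, Matrix.of_apply, mul_sub, Finset.sum_sub_distrib,
    Finset.sum_mul]

theorem sum_mul_sum_eq_half {N : ℕ} (g : Fin N → Fin N → ℝ) (hg : ∀ i j, g i j = -g j i)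
    (β : Fin N → ℝ) : ∑ i, β i * ∑ j, g i j = 1 / 2 * ∑ i, ∑ j, g i j * (β i - β j) := by
  have h : ∑ i, ∑ j, g i j * β j = - ∑ i, ∑ j, g i j * β i := by
    rw [Finset.sum_comm, ← Finset.sum_neg_distrib]
    refine Finset.sum_congr rfl fun i _ => ?_
    rw [← Finset.sum_neg_distrib]
    refine Finset.sum_congr rfl fun j _ => ?_
    rw [hg]; ring
  have h' : ∑ i, β i * ∑ j, g i j = ∑ i, ∑ j, g i j * β i :=
    Finset.sum_congr rfl fun i _ => by rw [mul_comm, Finset.sum_mul]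
  simp only [mul_sub, Finset.sum_sub_distrib]
  rw [h, h']
  ring

theorem weightLaplacian_dotProduct {N : ℕ} (w : Fin N → Fin N → ℝ)
    (hw : ∀ i j, w i j = w j i) (α β : Fin N → ℝ) :
    β ⬝ᵥ (weightLaplacian w *ᵥ α) =
      1 / 2 * ∑ i, ∑ j, w i j * (α i - α j) * (β i - β j) := by
  simp only [dotProduct, weightLaplacian_mulVec]
  exact sum_mul_sum_eq_half (fun i j => w i j * (α i - α j))
    (fun i j => by rw [hw i j]; ring) β

theorem weightLaplacian_dotProduct_comm {N : ℕ} (w : Fin N → Fin N → ℝ)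
    (hw : ∀ i j, w i j = w j i) (α β : Fin N → ℝ) :
    β ⬝ᵥ (weightLaplacian w *ᵥ α) = α ⬝ᵥ (weightLaplacian w *ᵥ β) := by
  rw [weightLaplacian_dotProduct w hw, weightLaplacian_dotProduct w hw]
  congr 1
  exact Finset.sum_congr rfl fun i _ => Finset.sum_congr rfl fun j _ => by ring

/-- The diagonal matrix of the indicator of two marked vertices. -/
def markedDiag {N : ℕ} (r s : Fin N) : Matrix (Fin N) (Fin N) ℝ :=
  Matrix.diagonal (Pi.single r 1 + Pi.single s 1)

/-- A stress `w` in equilibrium at `a` is nondegenerate when, after pinning two vertices with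
distinct coordinates, its Laplacian has no kernel. -/
theorem det_add_smul_markedDiag_ne_zero_iff {N : ℕ} {w : Fin N → Fin N → ℝ}
    (hw : ∀ i j, w i j = w j i) {a : Fin N → ℝ} (ha : weightLaplacian w *ᵥ a = 0)
    {r s : Fin N} (hrs : a r ≠ a s) {t : ℝ} (ht : t ≠ 0) :
    (weightLaplacian w + t • markedDiag r s).det ≠ 0 ↔
      ∀ β, weightLaplacian w *ᵥ β = 0 → β r = 0 → β s = 0 → β = 0 := by
  have hrs' : r ≠ s := fun h => hrs (by rw [h])
  have key : ∀ β, (t • markedDiag r s) *ᵥ β =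
      fun i => t * ((Pi.single r 1 + Pi.single s 1 : Fin N → ℝ) i * β i) := by
    intro β
    ext i
    simp [markedDiag, Matrix.smul_mulVec, Matrix.mulVec_diagonal]
  have keyγ : ∀ β γ : Fin N → ℝ, γ ⬝ᵥ ((t • markedDiag r s) *ᵥ β) =
      t * (γ r * β r + γ s * β s) := by
    intro β γ
    rw [key]
    simp only [dotProduct, Pi.add_apply, Pi.single_apply, add_mul, mul_add, ite_mul, one_mul,
      zero_mul, mul_ite, mul_zero, Finset.sum_add_distrib, Finset.sum_ite_eq', Finset.mem_univ,
      if_true]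
    ring
  rw [Ne, ← not_iff_not, not_not, ← Matrix.exists_mulVec_eq_zero_iff]
  push Not
  constructor
  · rintro ⟨β, hβ, h⟩
    rw [Matrix.add_mulVec] at h
    have h1 := congrArg (fun x => (fun _ => (1:ℝ)) ⬝ᵥ x) h
    have h2 := congrArg (fun x => a ⬝ᵥ x) h
    simp only [dotProduct_add, keyγ, dotProduct_zero] at h1 h2
    rw [weightLaplacian_dotProduct_comm w hw] at h1 h2
    rw [ha, dotProduct_zero, zero_add] at h2
    have h0 : weightLaplacian w *ᵥ (fun _ => (1:ℝ)) = 0 := by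
      ext i
      simp [weightLaplacian_mulVec]
    rw [h0, dotProduct_zero, zero_add] at h1
    have h1' := (mul_eq_zero.1 h1).resolve_left ht
    have h2' := (mul_eq_zero.1 h2).resolve_left ht
    have hr : β r = 0 := by
      have : (a r - a s) * β r = 0 := by linear_combination h2' - a s * h1'
      exact (mul_eq_zero.1 this).resolve_left (sub_ne_zero.2 hrs)
    have hs : β s = 0 := by rw [hr] at h1'; linarith
    refine ⟨β, ?_, hr, hs, hβ⟩
    have h3 : (t • markedDiag r s) *ᵥ β = 0 := by
      rw [key]
      ext i
      simp only [Pi.add_apply, Pi.single_apply, Pi.zero_apply]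
      by_cases hi : i = r
      · simp [hi, hr]
      · by_cases hi' : i = s
        · simp [hi', hs]
        · simp [hi, hi']
    rwa [h3, add_zero] at h
  · rintro ⟨β, h, hr, hs, hβ⟩
    refine ⟨β, hβ, ?_⟩
    rw [Matrix.add_mulVec, h, key, zero_add]
    ext i
    simp only [Pi.add_apply, Pi.single_apply, Pi.zero_apply]
    by_cases hi : i = r
    · simp [hi, hr]
    · by_cases hi' : i = s
      · simp [hi', hs]
      · simp [hi, hi']

/-- Perturbing any equilibrium stress in the direction of a nondegenerate one makes it
nondegenerate, except for finitely many parameters. -/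
theorem eventually_det_ne_zero {N : ℕ} {w v : Fin N → Fin N → ℝ}
    (hw : ∀ i j, w i j = w j i) (hv : ∀ i j, v i j = v j i) {a : Fin N → ℝ}
    (haw : weightLaplacian w *ᵥ a = 0) (hav : weightLaplacian v *ᵥ a = 0)
    {r s : Fin N} (hrs : a r ≠ a s)
    (hvnd : ∀ β, weightLaplacian v *ᵥ β = 0 → β r = 0 → β s = 0 → β = 0) :
    ∀ᶠ t : ℝ in 𝓝[≠] 0,
      (weightLaplacian (fun i j => w i j + t * v i j) + markedDiag r s).det ≠ 0 := by
  set A := weightLaplacian v + markedDiag r s with hA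
  set B := weightLaplacian w with hB
  have hAdet : A.det ≠ 0 := by
    have := (det_add_smul_markedDiag_ne_zero_iff hv hav hrs one_ne_zero).2 hvnd
    rwa [one_smul] at this
  set P : Polynomial ℝ :=
    (((Polynomial.X : Polynomial ℝ) • A.map Polynomial.C + B.map Polynomial.C)).det with hP
  have hP0 : P ≠ 0 := by
    intro h
    have h1 := Polynomial.coeff_det_X_add_C_card A B
    rw [← hP, h, Polynomial.coeff_zero] at h1
    exact hAdet h1.symm
  have heval : ∀ t : ℝ, P.eval t = (t • A + B).det := by
    intro t
    rw [hP, ← Polynomial.coe_evalRingHom, RingHom.map_det]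
    congr 1
    ext i j
    simp [Matrix.smul_apply, mul_comm t]
  have hfin : (P.roots.toFinset : Set ℝ).Finite := Finset.finite_toSet _
  have h1 : ∀ᶠ t : ℝ in 𝓝[≠] 0, t ∉ (P.roots.toFinset : Set ℝ) := by
    have := (hfin.subset (t := (P.roots.toFinset : Set ℝ) \ {0}) sdiff_subset).isClosed.isOpen_compl
    have h2 : ((P.roots.toFinset : Set ℝ) \ {0})ᶜ ∈ 𝓝 (0:ℝ) := this.mem_nhds (by simp)
    filter_upwards [mem_nhdsWithin_of_mem_nhds h2, self_mem_nhdsWithin] with t ht ht0 htP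
    exact ht ⟨htP, ht0⟩
  filter_upwards [h1, self_mem_nhdsWithin] with t ht ht0
  have hne : (t • A + B).det ≠ 0 := by
    rw [← heval]
    intro h
    exact ht (by simp [hP0, h])
  have hLap : weightLaplacian (fun i j => w i j + t * v i j) = B + t • weightLaplacian v := by
    ext i j
    simp only [hB, weightLaplacian, Matrix.sub_apply, Matrix.add_apply, Matrix.smul_apply,
      Matrix.of_apply, Matrix.diagonal_apply, smul_eq_mul, Finset.sum_add_distrib,
      ← Finset.mul_sum]
    split_ifs <;> ring
  have hsym : ∀ i j, w i j + t * v i j = w j i + t * v j i := fun i j => by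
    rw [hw i j, hv i j]
  have hal : weightLaplacian (fun i j => w i j + t * v i j) *ᵥ a = 0 := by
    rw [hLap, Matrix.add_mulVec, Matrix.smul_mulVec, haw, hav, smul_zero, add_zero]
  have h3 := (det_add_smul_markedDiag_ne_zero_iff hsym hal hrs (t := t) ht0).1 (by
    rw [hLap]
    convert hne using 2
    rw [hA, smul_add]
    abel)
  have h4 := (det_add_smul_markedDiag_ne_zero_iff hsym hal hrs one_ne_zero).2 h3
  rwa [one_smul] at h4

/-- Combinatorial consequences of the construction of a triangulated Laman graph: it is
connected, and at every line configuration it carries a nondegenerate equilibrium stress. -/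
theorem IsTLG.exists_base_edge {N : ℕ} {G : SimpleGraph (Fin N)} (hG : IsTLG G) :
    ∃ r s : Fin N, G.Adj r s ∧
      (∀ γ : Fin N → ℝ, (∀ i j, G.Adj i j → γ i = γ j) → ∀ i, γ i = γ r) ∧
      (∀ a : Fin N → ℝ, (∀ i j, G.Adj i j → a i ≠ a j) →
        ∃ v : Fin N → Fin N → ℝ, (∀ i j, v i j = v j i) ∧ (∀ i j, ¬ G.Adj i j → v i j = 0) ∧
          weightLaplacian v *ᵥ a = 0 ∧
          ∀ β, weightLaplacian v *ᵥ β = 0 → β r = 0 → β s = 0 → β = 0) := by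
  obtain ⟨hN, σ, p, q, hpq, hadj⟩ := hG
  have hkp : ∀ k : Fin N, 2 ≤ (k : ℕ) → G.Adj (σ k) (σ (p k)) := fun k hk =>
    (hadj _ _).2 (by tauto)
  have hkq : ∀ k : Fin N, 2 ≤ (k : ℕ) → G.Adj (σ k) (σ (q k)) := fun k hk =>
    (hadj _ _).2 (by tauto)
  have hind : ∀ P : Fin N → Prop, P (σ ⟨0, by omega⟩) → P (σ ⟨1, by omega⟩) →
      (∀ k : Fin N, 2 ≤ (k : ℕ) → P (σ (p k)) → P (σ (q k)) → P (σ k)) → ∀ i, P i := by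
    intro P h0 h1 hk
    have : ∀ n, ∀ h : n < N, P (σ ⟨n, h⟩) := by
      intro n
      induction n using Nat.strong_induction_on with
      | _ n ih =>
        intro h
        rcases Nat.lt_or_ge n 2 with h2 | h2
        · interval_cases n
          · exact h0
          · exact h1
        · have := hpq ⟨n, h⟩ h2
          exact hk _ h2 (ih _ this.1 (p ⟨n, h⟩).2) (ih _ this.2.1 (q ⟨n, h⟩).2)
    intro i
    have := this (σ.symm i) (σ.symm i).2
    simpa using this
  have h01 : G.Adj (σ ⟨0, by omega⟩) (σ ⟨1, by omega⟩) := (hadj _ _).2 (by simp)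
  refine ⟨_, _, h01, ?_, ?_⟩
  · intro γ hγ
    refine hind _ rfl (hγ _ _ h01).symm fun k hk h1 _ => ?_
    rw [hγ _ _ (hkp k hk), h1]
  · intro a ha
    let lam : Fin N → Fin N → ℝ := fun k =>
      if 2 ≤ (k : ℕ) then Pi.single (σ k) (a (σ (p k)) - a (σ (q k)))
        + Pi.single (σ (p k)) (a (σ (q k)) - a (σ k))
        + Pi.single (σ (q k)) (a (σ k) - a (σ (p k))) else 0
    have hlam : ∀ (k : Fin N) (γ : Fin N → ℝ), 2 ≤ (k : ℕ) → ∑ j, lam k j * γ j =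
        (a (σ (p k)) - a (σ (q k))) * γ (σ k) + (a (σ (q k)) - a (σ k)) * γ (σ (p k))
          + (a (σ k) - a (σ (p k))) * γ (σ (q k)) := by
      intro k γ hk
      simp only [lam, if_pos hk, Pi.add_apply, Pi.single_apply, add_mul, ite_mul, zero_mul,
        Finset.sum_add_distrib, Finset.sum_ite_eq', Finset.mem_univ, if_true]
    have hlam0 : ∀ k : Fin N, ¬ 2 ≤ (k : ℕ) → lam k = 0 := fun k hk => if_neg hk
    have hsum0 : ∀ k, ∑ j, lam k j = 0 := by
      intro k
      by_cases hk : 2 ≤ (k : ℕ)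
      · have := hlam k (fun _ => 1) hk
        simp only [mul_one] at this
        rw [this]; ring
      · simp [hlam0 k hk]
    have hsuma : ∀ k, ∑ j, lam k j * a j = 0 := by
      intro k
      by_cases hk : 2 ≤ (k : ℕ)
      · rw [hlam k a hk]; ring
      · simp [hlam0 k hk]
    have hlapv : ∀ β : Fin N → ℝ, ∀ i,
        (weightLaplacian (fun i j => if i = j then 0 else - ∑ k, lam k i * lam k j) *ᵥ β) i
          = ∑ k, lam k i * ∑ j, lam k j * β j := by
      intro β i
      rw [weightLaplacian_mulVec]
      have : ∀ j, (if i = j then 0 else - ∑ k, lam k i * lam k j) * (β i - β j)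
          = ∑ k, (lam k i * (lam k j * β j) - lam k i * β i * lam k j) := by
        intro j
        by_cases hij : i = j
        · subst hij
          simp only [sub_self, mul_zero]
          symm
          refine Finset.sum_eq_zero fun k _ => by ring
        · rw [if_neg hij, neg_mul, Finset.sum_mul, ← Finset.sum_neg_distrib]
          exact Finset.sum_congr rfl fun k _ => by ring
      simp only [this]
      rw [Finset.sum_comm]
      refine Finset.sum_congr rfl fun k _ => ?_
      rw [Finset.sum_sub_distrib, ← Finset.mul_sum, ← Finset.mul_sum, hsum0]
      ring
    refine ⟨fun i j => if i = j then 0 else - ∑ k, lam k i * lam k j, ?_, ?_, ?_, ?_⟩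
    · intro i j
      by_cases hij : i = j
      · simp [hij]
      · simp only [hij, Ne.symm hij, if_false, mul_comm]
    · intro i j hij
      by_cases hij' : i = j
      · simp [hij']
      · simp only [hij', if_false, neg_eq_zero]
        refine Finset.sum_eq_zero fun k _ => ?_
        by_cases hk : 2 ≤ (k : ℕ)
        · have hsupp : ∀ i, lam k i ≠ 0 → i = σ k ∨ i = σ (p k) ∨ i = σ (q k) := by
            intro i hi
            by_contra! hne
            apply hi
            simp [lam, if_pos hk, hne.1, hne.2.1, hne.2.2]
          by_contra hne
          have h1 := hsupp i (left_ne_zero_of_mul hne)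
          have h2 := hsupp j (right_ne_zero_of_mul hne)
          have e1 := hkp k hk
          have e2 := hkq k hk
          have e3 := (hpq k hk).2.2.2
          apply hij
          rcases h1 with rfl | rfl | rfl <;> rcases h2 with rfl | rfl | rfl <;>
            first
              | exact absurd rfl hij'
              | assumption
              | (apply SimpleGraph.Adj.symm; assumption)
        · simp [hlam0 k hk]
    · ext i
      rw [hlapv]
      simp [hsuma]
    · intro β hβ h0 h1
      have hsq : ∑ k, (∑ j, lam k j * β j) ^ 2 = 0 := by
        have h2 : ∑ i, β i * ∑ k, lam k i * ∑ j, lam k j * β j = 0 := by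
          refine Finset.sum_eq_zero fun i _ => ?_
          rw [← hlapv, hβ]
          simp
        rw [← h2]
        simp only [Finset.mul_sum]
        rw [Finset.sum_comm]
        refine Finset.sum_congr rfl fun k _ => ?_
        rw [sq, Finset.sum_mul]
        refine Finset.sum_congr rfl fun i _ => ?_
        rw [Finset.mul_sum]
        exact Finset.sum_congr rfl fun j _ => by ring
      rw [Finset.sum_eq_zero_iff_of_nonneg fun _ _ => sq_nonneg _] at hsq
      have hall := hind (fun i => β i = 0) h0 h1 (by
        intro k hk hp hq
        have h3 := hsq k (Finset.mem_univ _)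
        rw [sq_eq_zero_iff, hlam k β hk, hp, hq] at h3
        have h4 := ha _ _ (hpq k hk).2.2.2
        simpa [sub_ne_zero.2 h4] using h3)
      exact funext hall

theorem MemF.differentiableAt {f : ℝ → ℝ} (hf : MemF f) {d : ℝ} (hd : 0 < d) :
    DifferentiableAt ℝ f d :=
  (hf.1.differentiableOn one_ne_zero).differentiableAt (Ioi_mem_nhds hd)

theorem continuousOn_tildeFn {f : ℝ → ℝ} (hf : ContDiffOn ℝ 1 f (Ioi 0)) :
    ContinuousOn (tildeFn f) (Ioi 0) :=
  continuousOn_id.mul hf.continuousOn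

theorem deriv_tildeFn {f : ℝ → ℝ} {d : ℝ} (hf : DifferentiableAt ℝ f d) :
    deriv (tildeFn f) d = f d + d * deriv f d := by
  have h : HasDerivAt (tildeFn f) (1 * f d + d * deriv f d) d :=
    (hasDerivAt_id d).mul hf.hasDerivAt
  rw [h.deriv, one_mul]

theorem MemF.strictMonoOn {f : ℝ → ℝ} (hf : MemF f) : StrictMonoOn (tildeFn f) (Ioi 0) :=
  strictMonoOn_of_deriv_pos (convex_Ioi 0) (continuousOn_tildeFn hf.1) (by
    rw [interior_Ioi]
    exact hf.2.1)

theorem intervalIntegrable_tildeFn {f : ℝ → ℝ} (hf : ContDiffOn ℝ 1 f (Ioi 0)) {a b : ℝ}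
    (ha : 0 < a) (hb : 0 < b) : IntervalIntegrable (tildeFn f) volume a b :=
  ((continuousOn_tildeFn hf).mono fun _ hx => lt_of_lt_of_le (lt_min ha hb) hx.1).intervalIntegrable

theorem FF.isOpen_ball (f : FF) {ε : ℝ} (hε : 0 < ε) :
    {g : FF | ∀ d > (0:ℝ), |g.1.1 d - f.1.1 d| + |deriv g.1.1 d - deriv f.1.1 d| < ε} ∈ 𝓝 f := by
  have h : IsOpen {g : C1Pos | ∀ d > (0:ℝ),
      |g.1 d - f.1.1 d| + |deriv g.1 d - deriv f.1.1 d| < ε} :=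
    TopologicalSpace.isOpen_generateFrom_of_mem
      ⟨f.1, fun _ => ε, continuousOn_const, fun _ _ => hε, rfl⟩
  exact (h.preimage continuous_subtype_val).mem_nhds (fun d _ => by simpa using hε)

theorem FF.continuousAt_eval (f : FF) {d : ℝ} (hd : 0 < d) :
    ContinuousAt (fun z : FF × ℝ => z.1.1.1 z.2) (f, d) := by
  rw [ContinuousAt, Metric.tendsto_nhds]
  intro ε hε
  have h1 := FF.isOpen_ball f (half_pos hε)
  have h2 := Metric.tendsto_nhds.1 (f.2.differentiableAt hd).continuousAt.tendsto _ (half_pos hε)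
  rw [nhds_prod_eq]
  filter_upwards [(eventually_of_mem h1 fun _ h => h).prod_mk (h2.and (Ioi_mem_nhds hd))]
    with z hz
  have h3 := hz.1 z.2 hz.2.2
  have h4 := hz.2.1
  rw [Real.dist_eq] at h4 ⊢
  calc |z.1.1.1 z.2 - f.1.1 d| ≤ |z.1.1.1 z.2 - f.1.1 z.2| + |f.1.1 z.2 - f.1.1 d| :=
        abs_sub_le _ _ _
    _ < ε / 2 + ε / 2 := by
        have := abs_nonneg (deriv z.1.1.1 z.2 - deriv f.1.1 z.2)
        linarith
    _ = ε := add_halves ε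

/-- On a compact set of positive reals, a small multiple of a continuous function stays below a
positive continuous function. -/
theorem eventually_mul_lt_of_isCompact {K : Set ℝ} (hK : IsCompact K) {ψ m : ℝ → ℝ}
    (hψ : ContinuousOn ψ K) (hm : ContinuousOn m K) (hpos : ∀ d ∈ K, 0 < m d) :
    ∀ᶠ t : ℝ in 𝓝 0, ∀ d ∈ K, |t| * ψ d < m d := by
  rcases K.eq_empty_or_nonempty with rfl | hne
  · simp
  obtain ⟨x, hx, hmin⟩ := hK.exists_isMinOn hne hm
  obtain ⟨y, hy, hmax⟩ := hK.exists_isMaxOn hne hψ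
  have h : Tendsto (fun t : ℝ => |t| * ψ y) (𝓝 0) (𝓝 (|0| * ψ y)) :=
    (continuous_abs.mul continuous_const).tendsto 0
  rw [abs_zero, zero_mul] at h
  filter_upwards [h.eventually_lt_const (hpos x hx)] with t ht d hd
  calc |t| * ψ d ≤ |t| * ψ y := mul_le_mul_of_nonneg_left (hmax hd) (abs_nonneg t)
    _ < m x := ht
    _ ≤ m d := hmin hd

section Perturbation

variable {φ : ℝ → ℝ} {K : Set ℝ}

/-- The function `f + t φ` as an element of `C1Pos`. -/
def C1Pos.addMul (f : C1Pos) (hφ : ContDiff ℝ 1 φ) (t : ℝ) : C1Pos :=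
  ⟨fun d => f.1 d + t * φ d, f.2.add (contDiff_const.mul hφ).contDiffOn⟩

theorem C1Pos.tendsto_addMul (f : C1Pos) (hφ : ContDiff ℝ 1 φ) (hK : IsCompact K)
    (hK0 : K ⊆ Ioi 0) (hφK : ∀ x ∉ K, φ x = 0) (hφK' : ∀ x ∉ K, deriv φ x = 0) :
    Tendsto (f.addMul hφ) (𝓝 0) (𝓝 f) := by
  refine TopologicalSpace.tendsto_nhds_generateFrom_iff.2 ?_
  rintro S ⟨g, δ, hδ, _, rfl⟩ hf
  have hcf := f.2.continuousOn_deriv_of_isOpen isOpen_Ioi le_rfl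
  have hcg := g.2.continuousOn_deriv_of_isOpen isOpen_Ioi le_rfl
  have hφ' : Continuous (deriv φ) := hφ.continuous_deriv le_rfl
  have hev := eventually_mul_lt_of_isCompact hK (ψ := fun d => |φ d| + |deriv φ d|)
    (m := fun d => δ d - (|f.1 d - g.1 d| + |deriv f.1 d - deriv g.1 d|))
    (hφ.continuous.abs.add hφ'.abs).continuousOn
    ((hδ.sub ((f.2.continuousOn.sub g.2.continuousOn).abs.add (hcf.sub hcg).abs)).mono hK0)
    (fun d hd => sub_pos.2 (hf d (hK0 hd)))
  filter_upwards [hev] with t ht d hd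
  have hfd : DifferentiableAt ℝ f.1 d :=
    (f.2.differentiableOn one_ne_zero).differentiableAt (Ioi_mem_nhds hd)
  have hφd : DifferentiableAt ℝ φ d := hφ.differentiable one_ne_zero d
  have hder : deriv (fun d => f.1 d + t * φ d) d = deriv f.1 d + t * deriv φ d :=
    (hfd.hasDerivAt.add (hφd.hasDerivAt.const_mul t)).deriv
  simp only [C1Pos.addMul, hder]
  by_cases hdK : d ∈ K
  · have h1 := ht d hdK
    have h2 : |f.1 d + t * φ d - g.1 d| ≤ |f.1 d - g.1 d| + |t| * |φ d| := by
      rw [← abs_mul]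
      rw [add_sub_right_comm]
      exact abs_add_le _ _
    have h3 : |deriv f.1 d + t * deriv φ d - deriv g.1 d| ≤
        |deriv f.1 d - deriv g.1 d| + |t| * |deriv φ d| := by
      rw [← abs_mul]
      rw [add_sub_right_comm]
      exact abs_add_le _ _
    rw [mul_add] at h1
    linarith
  · rw [hφK d hdK, hφK' d hdK]
    simpa using hf d hd

theorem MemF.eventually_add_mul {f : ℝ → ℝ} (hf : MemF f) (hφ : ContDiff ℝ 1 φ)
    (hK : IsCompact K) (hK0 : K ⊆ Ioi 0) (hφK : ∀ x ∉ K, φ x = 0)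
    (hφK' : ∀ x ∉ K, deriv φ x = 0) :
    ∀ᶠ t : ℝ in 𝓝 0, MemF (fun d => f d + t * φ d) := by
  have hφ' : Continuous (deriv φ) := hφ.continuous_deriv le_rfl
  have hcf := hf.1.continuousOn_deriv_of_isOpen isOpen_Ioi le_rfl
  have hderiv := eventually_mul_lt_of_isCompact hK (ψ := fun d => |φ d + d * deriv φ d|)
    (m := deriv (tildeFn f))
    (hφ.continuous.add (continuous_id.mul hφ')).abs.continuousOn
    (ContinuousOn.congr ((hf.1.continuousOn.add (continuousOn_id.mul hcf)).mono hK0)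
      fun d hd => deriv_tildeFn (hf.differentiableAt (hK0 hd)))
    (fun d hd => hf.2.1 d (hK0 hd))
  obtain ⟨z, hz, hfz⟩ := hf.2.2.1
  have hneg : tildeFn f (z / 2) < 0 := by
    rw [← hfz]
    exact hf.strictMonoOn (half_pos hz) hz (half_lt_self hz)
  have hpos : 0 < tildeFn f (2 * z) := by
    rw [← hfz]
    exact hf.strictMonoOn hz (mem_Ioi.2 (by linarith)) (by linarith)
  have htend : ∀ d, Tendsto (fun t : ℝ => tildeFn (fun d => f d + t * φ d) d) (𝓝 0)
      (𝓝 (tildeFn f d)) := by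
    intro d
    have : Continuous fun t : ℝ => tildeFn (fun d => f d + t * φ d) d := by
      unfold tildeFn
      fun_prop
    simpa [tildeFn] using this.tendsto 0
  filter_upwards [hderiv, (htend _).eventually_lt_const hneg, (htend _).eventually_const_lt hpos]
    with t h1 h2 h3
  have hsmooth : ContDiffOn ℝ 1 (fun d => f d + t * φ d) (Ioi 0) :=
    hf.1.add (contDiff_const.mul hφ).contDiffOn
  refine ⟨hsmooth, ?_, ?_, ?_⟩
  · intro d hd
    have hfd := hf.differentiableAt hd
    have hφd : DifferentiableAt ℝ φ d := hφ.differentiable one_ne_zero d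
    have hadd : HasDerivAt (fun d => f d + t * φ d) (deriv f d + t * deriv φ d) d :=
      hfd.hasDerivAt.add (hφd.hasDerivAt.const_mul t)
    rw [deriv_tildeFn hadd.differentiableAt, hadd.deriv]
    have h4 := hf.2.1 d hd
    rw [deriv_tildeFn hfd] at h4
    by_cases hdK : d ∈ K
    · have h5 := h1 d hdK
      rw [deriv_tildeFn hfd, ← abs_mul] at h5
      have h6 := neg_abs_le (t * (φ d + d * deriv φ d))
      linarith
    · rw [hφK d hdK, hφK' d hdK]
      simpa using h4
  · have hle : z / 2 ≤ 2 * z := by linarith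
    obtain ⟨x, hx, hx0⟩ := intermediate_value_Icc hle
      ((continuousOn_tildeFn hsmooth).mono fun x hx => lt_of_lt_of_le (half_pos hz) hx.1)
      ⟨h2.le, h3.le⟩
    exact ⟨x, lt_of_lt_of_le (half_pos hz) hx.1, hx0⟩
  · have hcont : Continuous fun x => x * (t * φ x) := continuous_id.mul
      (continuous_const.mul hφ.continuous)
    have hlim : Tendsto (fun d => ∫ x in d..(1:ℝ), x * (t * φ x)) (𝓝[>] (0:ℝ))
        (𝓝 (∫ x in (0:ℝ)..(1:ℝ), x * (t * φ x))) := by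
      have : Continuous fun d => ∫ x in d..(1:ℝ), x * (t * φ x) := by
        simp_rw [intervalIntegral.integral_symm (1:ℝ)]
        exact (intervalIntegral.continuous_primitive
          (fun a b => hcont.intervalIntegrable a b) 1).neg
      exact (this.tendsto 0).mono_left nhdsWithin_le_nhds
    refine (hf.2.2.2.atBot_add hlim).congr' ?_
    filter_upwards [self_mem_nhdsWithin] with d hd
    rw [← intervalIntegral.integral_add (intervalIntegrable_tildeFn hf.1 hd one_pos)
      (hcont.intervalIntegrable _ _)]
    refine intervalIntegral.integral_congr fun x _ => ?_
    simp only [tildeFn]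
    ring

end Perturbation

/-- The value of an interaction law at a given distance can be varied linearly within any
neighbourhood in the Whitney topology. -/
theorem FF.eventually_exists_perturbation (f : FF) {O : Set FF} (hO : O ∈ 𝓝 f) {d : ℝ}
    (hd : 0 < d) (v : ℝ) : ∀ᶠ t : ℝ in 𝓝 0, ∃ g ∈ O, g.1.1 d = f.1.1 d + t * v := by
  let b : ContDiffBump d := ⟨d / 4, d / 2, by linarith, by linarith⟩
  have hφ : ContDiff ℝ 1 (fun x => v * b x) := contDiff_const.mul b.contDiff
  have hK0 : Metric.closedBall d (d / 2) ⊆ Ioi 0 := by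
    intro x hx
    rw [Metric.mem_closedBall, Real.dist_eq, abs_le] at hx
    exact mem_Ioi.2 (by linarith)
  have hsupp : tsupport (fun x => v * b x) ⊆ Metric.closedBall d (d / 2) := by
    refine (closure_mono ?_).trans b.tsupport_eq.subset
    intro x hx
    exact right_ne_zero_of_mul hx
  have hφK : ∀ x ∉ Metric.closedBall d (d / 2), v * b x = 0 := fun x hx =>
    image_eq_zero_of_notMem_tsupport (f := fun x => v * b x) fun h => hx (hsupp h)
  have hφK' : ∀ x ∉ Metric.closedBall d (d / 2), deriv (fun x => v * b x) x = 0 := fun x hx => by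
    by_contra hne
    exact hx (hsupp (support_deriv_subset hne))
  obtain ⟨u, hu, huO⟩ := mem_nhds_subtype _ _ _ |>.1 hO
  filter_upwards [(C1Pos.tendsto_addMul f.1 hφ (isCompact_closedBall _ _) hK0 hφK hφK') hu,
    MemF.eventually_add_mul f.2 hφ (isCompact_closedBall _ _) hK0 hφK hφK'] with t ht hmem
  refine ⟨⟨_, hmem⟩, huO ht, ?_⟩
  have : b d = 1 := b.one_of_mem_closedBall (Metric.mem_closedBall_self b.rIn_pos.le)
  simp [this]

section EdgePotential

variable {E : Type*} [NormedAddCommGroup E] [NormedSpace ℝ E] (X Y : E →L[ℝ] ℝ)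

theorem hasFDerivAt_sqrt_sq_add_sq {q : E} (hq : 0 < (X q) ^ 2 + (Y q) ^ 2) :
    HasFDerivAt (fun q => √((X q) ^ 2 + (Y q) ^ 2))
      ((√((X q) ^ 2 + (Y q) ^ 2))⁻¹ • (X q • X + Y q • Y)) q := by
  have h := ((X.hasFDerivAt (x := q).pow 2).add (Y.hasFDerivAt (x := q).pow 2)).sqrt hq.ne'
  refine h.congr_fderiv ?_
  ext u
  simp
  ring

theorem hasFDerivAt_edgePotential {f : ℝ → ℝ} (hf : MemF f) {q : E}
    (hq : 0 < (X q) ^ 2 + (Y q) ^ 2) :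
    HasFDerivAt (fun q => ∫ x in (1:ℝ)..√((X q) ^ 2 + (Y q) ^ 2), x * f x)
      (f √((X q) ^ 2 + (Y q) ^ 2) • (X q • X + Y q • Y)) q := by
  set r := √((X q) ^ 2 + (Y q) ^ 2) with hr
  have hr0 : 0 < r := Real.sqrt_pos.2 hq
  have hcont := continuousOn_tildeFn hf.1
  have h1 : HasDerivAt (fun u => ∫ x in (1:ℝ)..u, x * f x) (r * f r) r :=
    intervalIntegral.integral_hasDerivAt_right
      (intervalIntegrable_tildeFn hf.1 one_pos hr0)
      (hcont.stronglyMeasurableAtFilter isOpen_Ioi _ hr0)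
      (hcont.continuousAt (Ioi_mem_nhds hr0))
  refine (h1.comp_hasFDerivAt q (hasFDerivAt_sqrt_sq_add_sq X Y hq)).congr_fderiv ?_
  rw [← hr, smul_smul]
  congr 1
  field_simp

theorem hasFDerivAt_edgeGradient {f : ℝ → ℝ} (hf : MemF f) {q : E}
    (hq : 0 < (X q) ^ 2 + (Y q) ^ 2) (v : E) :
    HasFDerivAt (fun q => f √((X q) ^ 2 + (Y q) ^ 2) * (X q * X v + Y q * Y v))
      (f √((X q) ^ 2 + (Y q) ^ 2) • (X v • X + Y v • Y) +
        ((deriv f √((X q) ^ 2 + (Y q) ^ 2) * (√((X q) ^ 2 + (Y q) ^ 2))⁻¹) *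
          (X q * X v + Y q * Y v)) • (X q • X + Y q • Y)) q := by
  have hr0 : 0 < √((X q) ^ 2 + (Y q) ^ 2) := Real.sqrt_pos.2 hq
  have h1 := (hf.differentiableAt hr0).hasDerivAt.comp_hasFDerivAt q
    (hasFDerivAt_sqrt_sq_add_sq X Y hq)
  have h2 := (X.hasFDerivAt (x := q).mul_const (X v)).add (Y.hasFDerivAt (x := q).mul_const (Y v))
  refine (h1.mul h2).congr_fderiv ?_
  ext u
  simp
  ring

end EdgePotential

section Potential

variable {N : ℕ}

/-- The first component of the relative position of two agents. -/
def relFst (i j : Fin N) : (Fin N → ℝ × ℝ) →L[ℝ] ℝ :=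
  (ContinuousLinearMap.fst ℝ ℝ ℝ).comp
    (ContinuousLinearMap.proj (R := ℝ) (φ := fun _ : Fin N => ℝ × ℝ) i -
      ContinuousLinearMap.proj (R := ℝ) (φ := fun _ : Fin N => ℝ × ℝ) j)

/-- The second component of the relative position of two agents. -/
def relSnd (i j : Fin N) : (Fin N → ℝ × ℝ) →L[ℝ] ℝ :=
  (ContinuousLinearMap.snd ℝ ℝ ℝ).comp
    (ContinuousLinearMap.proj (R := ℝ) (φ := fun _ : Fin N => ℝ × ℝ) i -
      ContinuousLinearMap.proj (R := ℝ) (φ := fun _ : Fin N => ℝ × ℝ) j)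

@[simp] theorem relFst_apply (i j : Fin N) (q : Fin N → ℝ × ℝ) :
    relFst i j q = (q i).1 - (q j).1 := rfl

@[simp] theorem relSnd_apply (i j : Fin N) (q : Fin N → ℝ × ℝ) :
    relSnd i j q = (q i).2 - (q j).2 := rfl

variable {G : SimpleGraph (Fin N)} {f : Fin N → Fin N → ℝ → ℝ}

theorem InConfigSpace.sq_add_sq_pos {q : Fin N → ℝ × ℝ} (hq : InConfigSpace G q) {i j : Fin N}
    (hij : G.Adj i j) : 0 < (relFst i j q) ^ 2 + (relSnd i j q) ^ 2 := by
  by_contra! h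
  refine hq i j hij (Prod.ext ?_ ?_)
  · rw [relFst_apply, relSnd_apply] at h
    nlinarith [sq_nonneg ((q i).1 - (q j).1), sq_nonneg ((q i).2 - (q j).2)]
  · rw [relFst_apply, relSnd_apply] at h
    nlinarith [sq_nonneg ((q i).1 - (q j).1), sq_nonneg ((q i).2 - (q j).2)]

theorem InConfigSpace.eventually {q : Fin N → ℝ × ℝ} (hq : InConfigSpace G q) :
    ∀ᶠ p in 𝓝 q, InConfigSpace G p := by
  unfold InConfigSpace
  simp only [eventually_all]
  intro i j hij
  exact (isOpen_ne_fun (continuous_apply i) (continuous_apply j)).mem_nhds (hq i j hij)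

/-- The differential of the potential. -/
noncomputable def potentialDeriv (G : SimpleGraph (Fin N)) (f : Fin N → Fin N → ℝ → ℝ)
    (q : Fin N → ℝ × ℝ) : (Fin N → ℝ × ℝ) →L[ℝ] ℝ :=
  (1 / 2 : ℝ) • ∑ i, ∑ j, if G.Adj i j then
    f i j (dist2 (q i) (q j)) • (relFst i j q • relFst i j + relSnd i j q • relSnd i j) else 0

theorem hasFDerivAt_potential (hf : ∀ i j, G.Adj i j → MemF (f i j)) {q : Fin N → ℝ × ℝ}
    (hq : InConfigSpace G q) :
    HasFDerivAt (potential G f) (potentialDeriv G f q) q := by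
  refine HasFDerivAt.const_mul (HasFDerivAt.fun_sum fun i _ => HasFDerivAt.fun_sum fun j _ => ?_) _
  split_ifs with hij
  · exact hasFDerivAt_edgePotential (relFst i j) (relSnd i j) (hf i j hij) (hq.sq_add_sq_pos hij)
  · exact hasFDerivAt_const _ _

/-- The second differential of the potential. -/
noncomputable def potentialDeriv₂ (G : SimpleGraph (Fin N)) (f : Fin N → Fin N → ℝ → ℝ)
    (q v : Fin N → ℝ × ℝ) : (Fin N → ℝ × ℝ) →L[ℝ] ℝ :=
  (1 / 2 : ℝ) • ∑ i, ∑ j, if G.Adj i j then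
    f i j (dist2 (q i) (q j)) • (relFst i j v • relFst i j + relSnd i j v • relSnd i j) +
      ((deriv (f i j) (dist2 (q i) (q j)) * (dist2 (q i) (q j))⁻¹) *
        (relFst i j q * relFst i j v + relSnd i j q * relSnd i j v)) •
          (relFst i j q • relFst i j + relSnd i j q • relSnd i j) else 0

theorem hasFDerivAt_potentialDeriv (hf : ∀ i j, G.Adj i j → MemF (f i j)) {q : Fin N → ℝ × ℝ}
    (hq : InConfigSpace G q) (v : Fin N → ℝ × ℝ) :
    HasFDerivAt (fun p => fderiv ℝ (potential G f) p v) (potentialDeriv₂ G f q v) q := by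
  have heq : (fun p => fderiv ℝ (potential G f) p v) =ᶠ[𝓝 q] fun p =>
      (1 / 2 : ℝ) * ∑ i, ∑ j, if G.Adj i j then f i j (dist2 (p i) (p j)) *
        (relFst i j p * relFst i j v + relSnd i j p * relSnd i j v) else 0 := by
    filter_upwards [hq.eventually] with p hp
    rw [(hasFDerivAt_potential hf hp).fderiv, potentialDeriv]
    simp only [_root_.smul_apply, _root_.sum_apply, smul_eq_mul]
    congr 1
    refine Finset.sum_congr rfl fun i _ => Finset.sum_congr rfl fun j _ => ?_
    split_ifs
    · simp [mul_add]
    · simp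
  refine HasFDerivAt.congr_of_eventuallyEq ?_ heq
  refine HasFDerivAt.const_mul (HasFDerivAt.fun_sum fun i _ => HasFDerivAt.fun_sum fun j _ => ?_) _
  split_ifs with hij
  · exact hasFDerivAt_edgeGradient (relFst i j) (relSnd i j) (hf i j hij)
      (hq.sq_add_sq_pos hij) v
  · exact hasFDerivAt_const _ _

theorem potentialDeriv₂_apply (q v u : Fin N → ℝ × ℝ) :
    potentialDeriv₂ G f q v u = 1 / 2 * ∑ i, ∑ j, if G.Adj i j then
      f i j (dist2 (q i) (q j)) * (relFst i j v * relFst i j u + relSnd i j v * relSnd i j u) +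
        deriv (f i j) (dist2 (q i) (q j)) * (dist2 (q i) (q j))⁻¹ *
          (relFst i j q * relFst i j v + relSnd i j q * relSnd i j v) *
            (relFst i j q * relFst i j u + relSnd i j q * relSnd i j u) else 0 := by
  simp only [potentialDeriv₂, _root_.smul_apply, _root_.sum_apply,
    smul_eq_mul]
  congr 1
  refine Finset.sum_congr rfl fun i _ => Finset.sum_congr rfl fun j _ => ?_
  split_ifs
  · simp [mul_add]
  · simp

theorem potentialDeriv₂_comm (q v u : Fin N → ℝ × ℝ) :
    potentialDeriv₂ G f q v u = potentialDeriv₂ G f q u v := by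
  rw [potentialDeriv₂_apply, potentialDeriv₂_apply]
  congr 1
  refine Finset.sum_congr rfl fun i _ => Finset.sum_congr rfl fun j _ => ?_
  split_ifs <;> ring

theorem hessian_potential (hf : ∀ i j, G.Adj i j → MemF (f i j)) {q : Fin N → ℝ × ℝ}
    (hq : InConfigSpace G q) :
    hessian (potential G f) q =
      Matrix.of fun u v => potentialDeriv₂ G f q (basisVec v) (basisVec u) := by
  ext u v
  simp only [hessian, Matrix.of_apply]
  rw [(hasFDerivAt_potentialDeriv hf hq _).fderiv]

/-- The displacement with coordinates `z` in the basis `basisVec`. -/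
def ofCoords (z : Fin N ⊕ Fin N → ℝ) : Fin N → ℝ × ℝ := fun i => (z (Sum.inl i), z (Sum.inr i))

theorem sum_smul_basisVec (z : Fin N ⊕ Fin N → ℝ) : ∑ v, z v • basisVec v = ofCoords z := by
  ext i
  · simp [Fintype.sum_sum_type, basisVec, ofCoords, Pi.single_apply, apply_ite]
  · simp [Fintype.sum_sum_type, basisVec, ofCoords, Pi.single_apply, apply_ite]

theorem hessian_potential_mulVec (hf : ∀ i j, G.Adj i j → MemF (f i j)) {q : Fin N → ℝ × ℝ}
    (hq : InConfigSpace G q) (z : Fin N ⊕ Fin N → ℝ) (u : Fin N ⊕ Fin N) :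
    (hessian (potential G f) q *ᵥ z) u = potentialDeriv₂ G f q (basisVec u) (ofCoords z) := by
  rw [hessian_potential hf hq, ← sum_smul_basisVec, map_sum]
  simp only [Matrix.mulVec, dotProduct, Matrix.of_apply, map_smul, smul_eq_mul]
  exact Finset.sum_congr rfl fun v _ => by rw [potentialDeriv₂_comm, mul_comm]

theorem hessian_potential_isHermitian (hf : ∀ i j, G.Adj i j → MemF (f i j))
    {q : Fin N → ℝ × ℝ} (hq : InConfigSpace G q) :
    (hessian (potential G f) q).IsHermitian := by
  rw [hessian_potential hf hq]
  ext u v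
  simp [potentialDeriv₂_comm q (basisVec u)]

theorem hessian_potential_mulVec_eq_zero_iff (hf : ∀ i j, G.Adj i j → MemF (f i j))
    {q : Fin N → ℝ × ℝ} (hq : InConfigSpace G q) (z : Fin N ⊕ Fin N → ℝ) :
    hessian (potential G f) q *ᵥ z = 0 ↔ ∀ y, potentialDeriv₂ G f q (ofCoords z) y = 0 := by
  constructor
  · intro h y
    have hy : ofCoords (Sum.elim (fun i => (y i).1) (fun i => (y i).2)) = y := rfl
    rw [← hy, ← sum_smul_basisVec (Sum.elim _ _), map_sum]
    refine Finset.sum_eq_zero fun u _ => ?_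
    rw [map_smul, potentialDeriv₂_comm, ← hessian_potential_mulVec hf hq, h]
    simp
  · intro h
    ext u
    rw [hessian_potential_mulVec hf hq, potentialDeriv₂_comm, h]
    rfl

end Potential

theorem n0_eq_finrank_ker {m : Type*} [Fintype m] [DecidableEq m] {M : Matrix m m ℝ}
    (hM : M.IsHermitian) : n0 M = Module.finrank ℝ (LinearMap.ker M.mulVecLin) := by
  have h1 := LinearMap.finrank_range_add_finrank_ker M.mulVecLin
  have h2 : M.rank = Module.finrank ℝ (LinearMap.range M.mulVecLin) := rfl
  rw [← h2, hM.rank_eq_card_non_zero_eigs, Module.finrank_fintype_fun_eq_card,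
    Fintype.card_subtype] at h1
  have h3 := Finset.card_filter_add_card_filter_not (s := (Finset.univ : Finset m))
    (fun i => hM.eigenvalues i ≠ 0)
  simp only [not_not, Finset.card_univ] at h3
  simp only [n0, inertia, dif_pos hM]
  omega

section Line

variable {N : ℕ} {G : SimpleGraph (Fin N)} {f : Fin N → Fin N → ℝ → ℝ}

/-- The weights `f_ij(d_ij)` of a line configuration with coordinates `a`. -/
noncomputable def edgeWeight (G : SimpleGraph (Fin N)) (f : Fin N → Fin N → ℝ → ℝ)
    (a : Fin N → ℝ) (i j : Fin N) : ℝ :=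
  if G.Adj i j then f i j |a i - a j| else 0

theorem edgeWeight_comm (hs : ∀ i j, f i j = f j i) (a : Fin N → ℝ) (i j : Fin N) :
    edgeWeight G f a i j = edgeWeight G f a j i := by
  simp only [edgeWeight, G.adj_comm i j, hs i j, abs_sub_comm (a i) (a j)]

/-- The line configuration with coordinates `a` on the line through `(vx, vy)` with
direction `(c, s)`. -/
def orientedLine (c s vx vy : ℝ) (a : Fin N → ℝ) : Fin N → ℝ × ℝ :=
  fun i => (c * a i + vx, s * a i + vy)

theorem lineConfig_eq_orientedLine (a : Fin N → ℝ) : lineConfig a = orientedLine 1 0 0 0 a := by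
  ext i <;> simp [lineConfig, orientedLine]

variable {c s vx vy : ℝ}

theorem dist2_orientedLine (hcs : c ^ 2 + s ^ 2 = 1) (a : Fin N → ℝ) (i j : Fin N) :
    dist2 (orientedLine c s vx vy a i) (orientedLine c s vx vy a j) = |a i - a j| := by
  rw [← Real.sqrt_sq_eq_abs]
  simp only [dist2, orientedLine]
  congr 1
  linear_combination (a i - a j) ^ 2 * hcs

theorem inConfigSpace_orientedLine_iff (hcs : c ^ 2 + s ^ 2 = 1) (a : Fin N → ℝ) :
    InConfigSpace G (orientedLine c s vx vy a) ↔ ∀ i j, G.Adj i j → a i ≠ a j := by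
  refine forall₃_congr fun i j _ => not_congr ⟨fun h => ?_, fun h => by simp [orientedLine, h]⟩
  obtain ⟨h1, h2⟩ := Prod.ext_iff.1 h
  simp only [orientedLine] at h1 h2
  linear_combination c * h1 + s * h2 - (a i - a j) * hcs

theorem inConfigSpace_lineConfig_iff (a : Fin N → ℝ) :
    InConfigSpace G (lineConfig a) ↔ ∀ i j, G.Adj i j → a i ≠ a j := by
  rw [lineConfig_eq_orientedLine]
  exact inConfigSpace_orientedLine_iff (by norm_num) a

theorem isEquilibrium_orientedLine_iff (hcs : c ^ 2 + s ^ 2 = 1) (a : Fin N → ℝ) :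
    IsEquilibrium G f (orientedLine c s vx vy a) ↔
      weightLaplacian (edgeWeight G f a) *ᵥ a = 0 := by
  rw [funext_iff]
  refine forall_congr' fun i => ?_
  have hterm : (∑ j, if G.Adj i j then
      (f i j (dist2 (orientedLine c s vx vy a i) (orientedLine c s vx vy a j))) •
        (orientedLine c s vx vy a j - orientedLine c s vx vy a i) else (0:ℝ×ℝ)) =
      (-(weightLaplacian (edgeWeight G f a) *ᵥ a) i) • (c, s) := by
    rw [weightLaplacian_mulVec, ← Finset.sum_neg_distrib, Finset.sum_smul]
    refine Finset.sum_congr rfl fun j _ => ?_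
    rw [dist2_orientedLine hcs, edgeWeight]
    split_ifs
    · ext <;> simp [orientedLine] <;> ring
    · simp
  rw [hterm, smul_eq_zero, neg_eq_zero, Pi.zero_apply]
  refine or_iff_left fun h => ?_
  obtain ⟨h1, h2⟩ := Prod.ext_iff.1 h
  simp only [Prod.fst_zero, Prod.snd_zero] at h1 h2
  rw [h1, h2] at hcs
  norm_num at hcs

theorem collinear_orientedLine (a : Fin N → ℝ) :
    Collinear ℝ (range (orientedLine c s vx vy a)) := by
  rw [collinear_iff_exists_forall_eq_smul_vadd]
  refine ⟨(vx, vy), (c, s), ?_⟩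
  rintro _ ⟨i, rfl⟩
  exact ⟨a i, by ext <;> simp [orientedLine, mul_comm]⟩

theorem exists_orientedLine_of_collinear {p : Fin N → ℝ × ℝ} (hp : Collinear ℝ (range p)) :
    ∃ c s vx vy : ℝ, c ^ 2 + s ^ 2 = 1 ∧ ∃ a, p = orientedLine c s vx vy a := by
  obtain ⟨p₀, v, hv⟩ := (collinear_iff_exists_forall_eq_smul_vadd (range p)).1 hp
  choose t ht using fun i => hv (p i) (mem_range_self i)
  rcases eq_or_ne v 0 with rfl | hv0
  · exact ⟨1, 0, p₀.1, p₀.2, by norm_num, fun _ => 0, by ext i <;> simp [orientedLine, ht i]⟩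
  · have hpos : 0 < v.1 ^ 2 + v.2 ^ 2 := by
      by_contra! h
      exact hv0 (Prod.ext (by simp; nlinarith [sq_nonneg v.1, sq_nonneg v.2])
        (by simp; nlinarith [sq_nonneg v.1, sq_nonneg v.2]))
    have hR : 0 < √(v.1 ^ 2 + v.2 ^ 2) := Real.sqrt_pos.2 hpos
    refine ⟨v.1 / √(v.1 ^ 2 + v.2 ^ 2), v.2 / √(v.1 ^ 2 + v.2 ^ 2), p₀.1, p₀.2, ?_,
      fun i => t i * √(v.1 ^ 2 + v.2 ^ 2), ?_⟩
    · rw [div_pow, div_pow, Real.sq_sqrt hpos.le, ← add_div, div_self hpos.ne']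
    · ext i
      · simp only [orientedLine, ht i, vadd_eq_add, Prod.fst_add, Prod.smul_fst, smul_eq_mul]
        field_simp
      · simp only [orientedLine, ht i, vadd_eq_add, Prod.snd_add, Prod.smul_snd, smul_eq_mul]
        field_simp

theorem sameOrbit_lineConfig_iff {a : Fin N → ℝ} {q : Fin N → ℝ × ℝ} :
    sameOrbit (lineConfig a) q ↔
      ∃ c s vx vy : ℝ, c ^ 2 + s ^ 2 = 1 ∧ q = orientedLine c s vx vy a := by
  simp only [sameOrbit, lineConfig, orientedLine, funext_iff, mul_zero, sub_zero, add_zero]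

/-- The displacement with longitudinal components `α` and transversal components `β`. -/
def framed (c s : ℝ) (α β : Fin N → ℝ) : Fin N → ℝ × ℝ :=
  fun i => (c * α i - s * β i, s * α i + c * β i)

theorem potentialDeriv₂_framed (hf : ∀ i j, G.Adj i j → MemF (f i j))
    (hcs : c ^ 2 + s ^ 2 = 1) {a : Fin N → ℝ} (ha : ∀ i j, G.Adj i j → a i ≠ a j)
    (α β α' β' : Fin N → ℝ) :
    potentialDeriv₂ G f (orientedLine c s vx vy a) (framed c s α β) (framed c s α' β') =
      1 / 2 * ∑ i, ∑ j, (if G.Adj i j then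
        deriv (tildeFn (f i j)) |a i - a j| * (α i - α j) * (α' i - α' j) +
          f i j |a i - a j| * (β i - β j) * (β' i - β' j) else 0) := by
  rw [potentialDeriv₂_apply]
  congr 1
  refine Finset.sum_congr rfl fun i _ => Finset.sum_congr rfl fun j _ => ?_
  split_ifs with hij
  · have hd : 0 < |a i - a j| := abs_pos.2 (sub_ne_zero.2 (ha i j hij))
    rw [dist2_orientedLine hcs, deriv_tildeFn ((hf i j hij).differentiableAt hd)]
    simp only [relFst_apply, relSnd_apply, orientedLine, framed]
    have h1 : ∀ γ δ : Fin N → ℝ, (c * a i + vx - (c * a j + vx)) *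
        (c * γ i - s * δ i - (c * γ j - s * δ j)) + (s * a i + vy - (s * a j + vy)) *
        (s * γ i + c * δ i - (s * γ j + c * δ j)) = (a i - a j) * (γ i - γ j) := by
      intro γ δ
      linear_combination (a i - a j) * (γ i - γ j) * hcs
    have h2 : (c * α i - s * β i - (c * α j - s * β j)) *
        (c * α' i - s * β' i - (c * α' j - s * β' j)) +
        (s * α i + c * β i - (s * α j + c * β j)) *
        (s * α' i + c * β' i - (s * α' j + c * β' j)) =
        (α i - α j) * (α' i - α' j) + (β i - β j) * (β' i - β' j) := by
      linear_combination ((α i - α j) * (α' i - α' j) + (β i - β j) * (β' i - β' j)) * hcs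
    rw [h1, h1, h2]
    have h3 : (a i - a j) ^ 2 = |a i - a j| ^ 2 := (sq_abs _).symm
    have h4 : |a i - a j|⁻¹ * (a i - a j) ^ 2 = |a i - a j| := by
      rw [h3]
      field_simp
    linear_combination deriv (f i j) |a i - a j| * (α i - α j) * (α' i - α' j) * h4
  · rfl

theorem n0_hessian_orientedLine (hf : ∀ i j, G.Adj i j → MemF (f i j))
    (hs : ∀ i j, f i j = f j i) (hcs : c ^ 2 + s ^ 2 = 1) {a : Fin N → ℝ}
    (ha : ∀ i j, G.Adj i j → a i ≠ a j) (heq : weightLaplacian (edgeWeight G f a) *ᵥ a = 0)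
    {r t : Fin N} (hrt : G.Adj r t)
    (hconn : ∀ γ : Fin N → ℝ, (∀ i j, G.Adj i j → γ i = γ j) → ∀ i, γ i = γ r)
    (hnd : ∀ β, weightLaplacian (edgeWeight G f a) *ᵥ β = 0 → β r = 0 → β t = 0 → β = 0) :
    n0 (hessian (potential G f) (orientedLine c s vx vy a)) = 3 := by
  have hconf : InConfigSpace G (orientedLine c s vx vy a) :=
    (inConfigSpace_orientedLine_iff hcs a).2 ha
  have hart : a r - a t ≠ 0 := sub_ne_zero.2 (ha r t hrt)
  have htrans : ∀ β η : Fin N → ℝ, 1 / 2 * ∑ i, ∑ j, (if G.Adj i j then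
      f i j |a i - a j| * (β i - β j) * (η i - η j) else 0) =
        η ⬝ᵥ (weightLaplacian (edgeWeight G f a) *ᵥ β) := by
    intro β η
    rw [weightLaplacian_dotProduct _ (edgeWeight_comm hs a)]
    congr 1
    refine Finset.sum_congr rfl fun i _ => Finset.sum_congr rfl fun j _ => ?_
    simp only [edgeWeight]
    split_ifs <;> ring
  have hone : weightLaplacian (edgeWeight G f a) *ᵥ (fun _ => (1:ℝ)) = 0 := by
    ext i
    simp [weightLaplacian_mulVec]
  rw [n0_eq_finrank_ker (hessian_potential_isHermitian hf hconf)]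
  let T : (Fin 3 → ℝ) →ₗ[ℝ] (Fin N ⊕ Fin N → ℝ) :=
    { toFun := fun x => Sum.elim (fun i => c * x 0 - s * (x 1 + x 2 * a i))
        (fun i => s * x 0 + c * (x 1 + x 2 * a i))
      map_add' := by
        intro x y
        ext u
        rcases u with i | i <;> simp <;> ring
      map_smul' := by
        intro m x
        ext u
        rcases u with i | i <;> simp <;> ring }
  have hT1 : ∀ x i, T x (Sum.inl i) = c * x 0 - s * (x 1 + x 2 * a i) := fun _ _ => rfl
  have hT2 : ∀ x i, T x (Sum.inr i) = s * x 0 + c * (x 1 + x 2 * a i) := fun _ _ => rfl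
  have hTinj : Injective T := by
    rw [injective_iff_map_eq_zero]
    intro x hx
    have e1 := congrFun hx (Sum.inl r)
    have e2 := congrFun hx (Sum.inr r)
    have e3 := congrFun hx (Sum.inl t)
    have e4 := congrFun hx (Sum.inr t)
    rw [hT1, Pi.zero_apply] at e1 e3
    rw [hT2, Pi.zero_apply] at e2 e4
    have x0 : x 0 = 0 := by linear_combination c * e1 + s * e2 - x 0 * hcs
    have k1 : x 1 + x 2 * a r = 0 := by
      linear_combination c * e2 - s * e1 - (x 1 + x 2 * a r) * hcs
    have k2 : x 1 + x 2 * a t = 0 := by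
      linear_combination c * e4 - s * e3 - (x 1 + x 2 * a t) * hcs
    have x2 : x 2 = 0 := by
      have : x 2 * (a r - a t) = 0 := by linear_combination k1 - k2
      exact (mul_eq_zero.1 this).resolve_right hart
    have x1 : x 1 = 0 := by rw [x2] at k1; linarith
    ext i
    fin_cases i <;> assumption
  have hker : LinearMap.ker (hessian (potential G f) (orientedLine c s vx vy a)).mulVecLin =
      LinearMap.range T := by
    ext z
    rw [LinearMap.mem_ker, Matrix.mulVecLin_apply, hessian_potential_mulVec_eq_zero_iff hf hconf,
      LinearMap.mem_range]
    constructor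
    · intro h
      set α : Fin N → ℝ := fun i => c * z (Sum.inl i) + s * z (Sum.inr i) with hα
      set β : Fin N → ℝ := fun i => c * z (Sum.inr i) - s * z (Sum.inl i) with hβ
      have hz1 : ∀ i, z (Sum.inl i) = c * α i - s * β i := fun i => by
        simp only [hα, hβ]
        linear_combination -z (Sum.inl i) * hcs
      have hz2 : ∀ i, z (Sum.inr i) = s * α i + c * β i := fun i => by
        simp only [hα, hβ]
        linear_combination -z (Sum.inr i) * hcs
      have hz : ofCoords z = framed c s α β := by
        ext i
        · exact hz1 i
        · exact hz2 i
      rw [hz] at h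
      have hαc : ∀ i, α i = α r := by
        refine hconn α fun i j hij => ?_
        have h1 := h (framed c s α 0)
        rw [potentialDeriv₂_framed hf hcs ha] at h1
        have hnn : ∀ i j, 0 ≤ (if G.Adj i j then
            deriv (tildeFn (f i j)) |a i - a j| * (α i - α j) * (α i - α j) +
              f i j |a i - a j| * (β i - β j) * ((0 : Fin N → ℝ) i - (0 : Fin N → ℝ) j)
                else 0) := by
          intro i j
          split_ifs with hij
          · have := (hf i j hij).2.1 _ (abs_pos.2 (sub_ne_zero.2 (ha i j hij)))
            simp only [Pi.zero_apply, sub_self, mul_zero, add_zero, mul_assoc]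
            exact mul_nonneg this.le (mul_self_nonneg _)
          · exact le_rfl
        have h2 := (mul_eq_zero.1 h1).resolve_left (by norm_num)
        rw [Finset.sum_eq_zero_iff_of_nonneg
          fun i _ => Finset.sum_nonneg fun j _ => hnn i j] at h2
        have h3 := h2 i (Finset.mem_univ _)
        rw [Finset.sum_eq_zero_iff_of_nonneg fun j _ => hnn i j] at h3
        have h4 := h3 j (Finset.mem_univ _)
        have h5 := (hf i j hij).2.1 _ (abs_pos.2 (sub_ne_zero.2 (ha i j hij)))
        simpa [hij, h5.ne', sub_eq_zero] using h4
      have hβ0 : weightLaplacian (edgeWeight G f a) *ᵥ β = 0 := by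
        ext i
        have h1 := h (framed c s 0 (Pi.single i 1))
        rw [potentialDeriv₂_framed hf hcs ha] at h1
        simp only [Pi.zero_apply, sub_self, mul_zero, zero_add] at h1
        rw [htrans, single_one_dotProduct] at h1
        exact h1
      set m := (β r - β t) / (a r - a t) with hm
      have hzero : β - ((β r - m * a r) • (fun _ => (1:ℝ)) + m • a) = 0 := by
        refine hnd _ ?_ ?_ ?_
        · rw [Matrix.mulVec_sub, Matrix.mulVec_add, Matrix.mulVec_smul, Matrix.mulVec_smul,
            hβ0, hone, heq]
          simp
        · simp
        · have : m * (a r - a t) = β r - β t := div_mul_cancel₀ _ hart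
          simp only [Pi.sub_apply, Pi.add_apply, Pi.smul_apply, smul_eq_mul, mul_one]
          linear_combination this
      have hβi : ∀ i, β i = (β r - m * a r) + m * a i := by
        intro i
        have := congrFun hzero i
        simp only [Pi.sub_apply, Pi.add_apply, Pi.smul_apply, smul_eq_mul, mul_one,
          Pi.zero_apply] at this
        linarith
      refine ⟨![α r, β r - m * a r, m], ?_⟩
      ext u
      rcases u with i | i
      · rw [hT1, hz1, hβi i, hαc i]
        simp
      · rw [hT2, hz2, hβi i, hαc i]
        simp
    · rintro ⟨x, rfl⟩ y
      have hy : y = framed c s (fun i => c * (y i).1 + s * (y i).2)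
          (fun i => c * (y i).2 - s * (y i).1) := by
        ext i
        · simp only [framed]
          linear_combination -(y i).1 * hcs
        · simp only [framed]
          linear_combination -(y i).2 * hcs
      have hx : ofCoords (T x) = framed c s (fun _ => x 0) (fun i => x 1 + x 2 * a i) := rfl
      rw [hy, hx, potentialDeriv₂_framed hf hcs ha]
      simp only [sub_self, mul_zero, zero_mul, zero_add]
      rw [htrans]
      have : (fun i => x 1 + x 2 * a i) = x 1 • (fun _ => (1:ℝ)) + x 2 • a := by
        ext i
        simp
      rw [this, Matrix.mulVec_add, Matrix.mulVec_smul, Matrix.mulVec_smul, hone, heq]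
      simp
  rw [hker, LinearMap.finrank_range_of_inj hTinj, Module.finrank_fin_fun]

/-- The line coordinates whose order along each edge is prescribed by `S`. -/
def sector (G : SimpleGraph (Fin N)) (S : Fin N → Fin N → Prop) : Set (Fin N → ℝ) :=
  {a | ∀ i j, G.Adj i j → a i ≠ a j ∧ (a i < a j ↔ S i j)}

theorem isOpen_sector (G : SimpleGraph (Fin N)) (S : Fin N → Fin N → Prop) :
    IsOpen (sector G S) := by
  refine isOpen_iff_eventually.2 fun a ha => ?_
  simp only [sector, mem_ofPred_eq, eventually_all]
  intro i j hij
  rcases lt_or_gt_of_ne (ha i j hij).1 with h | h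
  · have hO : IsOpen {b : Fin N → ℝ | b i < b j} :=
      isOpen_lt (continuous_apply i) (continuous_apply j)
    filter_upwards [hO.mem_nhds h] with b hb
    exact ⟨ne_of_lt hb, iff_of_true hb ((ha i j hij).2.1 h)⟩
  · have hO : IsOpen {b : Fin N → ℝ | b j < b i} :=
      isOpen_lt (continuous_apply j) (continuous_apply i)
    filter_upwards [hO.mem_nhds h] with b hb
    exact ⟨ne_of_gt hb,
      iff_of_false (not_lt_of_gt hb) fun hS => not_lt_of_gt h ((ha i j hij).2.2 hS)⟩

theorem mem_sector_self {a : Fin N → ℝ} (ha : ∀ i j, G.Adj i j → a i ≠ a j) :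
    a ∈ sector G (fun i j => a i < a j) := fun i j hij => ⟨ha i j hij, Iff.rfl⟩

theorem MemF.mul_sub_pos {g : ℝ → ℝ} (hg : MemF g) {x y : ℝ} (hx : x ≠ 0) (hy : y ≠ 0)
    (hxy : x < 0 ↔ y < 0) (hne : x ≠ y) : 0 < (g |x| * x - g |y| * y) * (x - y) := by
  have hmono := hg.strictMonoOn
  have key : ∀ u v : ℝ, 0 < u → 0 < v → u ≠ v → 0 < (g u * u - g v * v) * (u - v) := by
    intro u v hu hv huv
    rcases lt_or_gt_of_ne huv with h | h
    · have := hmono hu hv h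
      simp only [tildeFn] at this
      exact mul_pos_of_neg_of_neg (by linarith) (by linarith)
    · have := hmono hv hu h
      simp only [tildeFn] at this
      exact mul_pos (by linarith) (by linarith)
  rcases lt_or_gt_of_ne hx with h | h
  · have h' := hxy.1 h
    rw [abs_of_neg h, abs_of_neg h']
    have := key (-x) (-y) (by linarith) (by linarith) (fun e => hne (neg_injective e))
    linarith
  · have h' : 0 < y := lt_of_le_of_ne (not_lt.1 fun hy' => not_lt_of_gt h (hxy.2 hy')) hy.symm
    rw [abs_of_pos h, abs_of_pos h']
    exact key x y h h' hne

theorem edgeWeight_monotone_aux (hf : ∀ i j, G.Adj i j → MemF (f i j))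
    {S : Fin N → Fin N → Prop} {a b : Fin N → ℝ} (ha : a ∈ sector G S) (hb : b ∈ sector G S)
    (i j : Fin N) :
    0 ≤ (edgeWeight G f a i j * (a i - a j) - edgeWeight G f b i j * (b i - b j)) *
      ((a i - a j) - (b i - b j)) ∧ (G.Adj i j →
    (edgeWeight G f a i j * (a i - a j) - edgeWeight G f b i j * (b i - b j)) *
      ((a i - a j) - (b i - b j)) = 0 → a i - b i = a j - b j) := by
  by_cases hij : G.Adj i j
  · simp only [edgeWeight, if_pos hij]
    by_cases hne : a i - a j = b i - b j
    · rw [hne]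
      exact ⟨by simp, fun _ _ => by linarith⟩
    · have := (hf i j hij).mul_sub_pos (sub_ne_zero.2 (ha i j hij).1)
        (sub_ne_zero.2 (hb i j hij).1)
        (by rw [sub_neg, sub_neg, (ha i j hij).2, (hb i j hij).2]) hne
      exact ⟨this.le, fun _ h => absurd h this.ne'⟩
  · simp [edgeWeight, hij]

theorem dotProduct_sub_nonneg (hf : ∀ i j, G.Adj i j → MemF (f i j)) (hs : ∀ i j, f i j = f j i)
    {S : Fin N → Fin N → Prop} {a b : Fin N → ℝ} (ha : a ∈ sector G S) (hb : b ∈ sector G S)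
    (heq : weightLaplacian (edgeWeight G f b) *ᵥ b = 0) :
    0 ≤ (a - b) ⬝ᵥ (weightLaplacian (edgeWeight G f a) *ᵥ a) ∧
      ((a - b) ⬝ᵥ (weightLaplacian (edgeWeight G f a) *ᵥ a) = 0 →
        ∀ i j, G.Adj i j → a i - b i = a j - b j) := by
  have h1 : (a - b) ⬝ᵥ (weightLaplacian (edgeWeight G f a) *ᵥ a) =
      1 / 2 * ∑ i, ∑ j, (edgeWeight G f a i j * (a i - a j) - edgeWeight G f b i j * (b i - b j)) *
      ((a i - a j) - (b i - b j)) := by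
    have h2 : (a - b) ⬝ᵥ (weightLaplacian (edgeWeight G f a) *ᵥ a) =
        (a - b) ⬝ᵥ (weightLaplacian (edgeWeight G f a) *ᵥ a) -
          (a - b) ⬝ᵥ (weightLaplacian (edgeWeight G f b) *ᵥ b) := by
      rw [heq, dotProduct_zero, sub_zero]
    rw [h2, weightLaplacian_dotProduct _ (edgeWeight_comm hs a),
      weightLaplacian_dotProduct _ (edgeWeight_comm hs b), ← mul_sub, ← Finset.sum_sub_distrib]
    congr 1
    refine Finset.sum_congr rfl fun i _ => ?_
    rw [← Finset.sum_sub_distrib]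
    refine Finset.sum_congr rfl fun j _ => ?_
    simp only [Pi.sub_apply]
    ring
  have hnn := fun i j => (edgeWeight_monotone_aux hf ha hb i j).1
  rw [h1]
  refine ⟨mul_nonneg (by norm_num) (Finset.sum_nonneg fun i _ => Finset.sum_nonneg fun j _ =>
    hnn i j), fun h i j hij => ?_⟩
  have h2 := (mul_eq_zero.1 h).resolve_left (by norm_num)
  rw [Finset.sum_eq_zero_iff_of_nonneg fun i _ => Finset.sum_nonneg fun j _ => hnn i j] at h2
  have h3 := h2 i (Finset.mem_univ _)
  rw [Finset.sum_eq_zero_iff_of_nonneg fun j _ => hnn i j] at h3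
  exact (edgeWeight_monotone_aux hf ha hb i j).2 hij (h3 j (Finset.mem_univ _))

/-- Each sector contains at most one equilibrium up to translation. -/
theorem sub_const_of_equilibria (hf : ∀ i j, G.Adj i j → MemF (f i j))
    (hs : ∀ i j, f i j = f j i) {S : Fin N → Fin N → Prop} {a b : Fin N → ℝ}
    (ha : a ∈ sector G S) (hb : b ∈ sector G S)
    (haeq : weightLaplacian (edgeWeight G f a) *ᵥ a = 0)
    (hbeq : weightLaplacian (edgeWeight G f b) *ᵥ b = 0) {r : Fin N}
    (hconn : ∀ γ : Fin N → ℝ, (∀ i j, G.Adj i j → γ i = γ j) → ∀ i, γ i = γ r) (i : Fin N) :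
    a i = b i + (a r - b r) := by
  have h := (dotProduct_sub_nonneg hf hs ha hb hbeq).2 (by rw [haeq, dotProduct_zero])
  have : a i - b i = a r - b r := hconn (fun i => a i - b i) h i
  linarith

theorem potentialDeriv_lineConfig (hs : ∀ i j, f i j = f j i) (a v : Fin N → ℝ) :
    potentialDeriv G f (lineConfig a) (lineConfig v) =
      v ⬝ᵥ (weightLaplacian (edgeWeight G f a) *ᵥ a) := by
  rw [weightLaplacian_dotProduct _ (edgeWeight_comm hs a), potentialDeriv]
  simp only [_root_.smul_apply, _root_.sum_apply, smul_eq_mul]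
  congr 1
  refine Finset.sum_congr rfl fun i _ => Finset.sum_congr rfl fun j _ => ?_
  have hd : dist2 (lineConfig a i) (lineConfig a j) = |a i - a j| := by
    rw [lineConfig_eq_orientedLine, dist2_orientedLine (by norm_num)]
  rw [hd, edgeWeight]
  split_ifs
  · simp [lineConfig, mul_assoc]
  · simp

end Line

section Ensemble

variable {N : ℕ} {G : SimpleGraph (Fin N)}

theorem ensembleLaws_of_adj (ω : G.edgeSet → FF) {i j : Fin N} (h : G.Adj i j) :
    ensembleLaws ω i j = (ω ⟨s(i, j), G.mem_edgeSet.mpr h⟩).1.1 := dif_pos h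

theorem memF_ensembleLaws (ω : G.edgeSet → FF) (i j : Fin N) (h : G.Adj i j) :
    MemF (ensembleLaws ω i j) := by
  rw [ensembleLaws_of_adj ω h]
  exact (ω _).2

theorem ensembleLaws_comm (ω : G.edgeSet → FF) (i j : Fin N) :
    ensembleLaws ω i j = ensembleLaws ω j i := by
  by_cases h : G.Adj i j
  · have he : (⟨s(i, j), G.mem_edgeSet.mpr h⟩ : G.edgeSet) =
        ⟨s(j, i), G.mem_edgeSet.mpr h.symm⟩ := Subtype.ext Sym2.eq_swap
    rw [ensembleLaws_of_adj ω h, ensembleLaws_of_adj ω h.symm, he]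
  · simp only [ensembleLaws, dif_neg h, dif_neg (mt SimpleGraph.Adj.symm h)]

theorem continuousAt_edgeWeight (ω : G.edgeSet → FF) {a : Fin N → ℝ}
    (ha : ∀ i j, G.Adj i j → a i ≠ a j) (i j : Fin N) :
    ContinuousAt (fun z : (G.edgeSet → FF) × (Fin N → ℝ) =>
      edgeWeight G (ensembleLaws z.1) z.2 i j) (ω, a) := by
  by_cases h : G.Adj i j
  · simp only [edgeWeight, if_pos h, ensembleLaws_of_adj _ h]
    have hpair : ContinuousAt (fun z : (G.edgeSet → FF) × (Fin N → ℝ) =>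
        (z.1 ⟨s(i, j), G.mem_edgeSet.mpr h⟩, |z.2 i - z.2 j|)) (ω, a) := by
      fun_prop
    exact ContinuousAt.comp (f := fun z : (G.edgeSet → FF) × (Fin N → ℝ) =>
        (z.1 ⟨s(i, j), G.mem_edgeSet.mpr h⟩, |z.2 i - z.2 j|))
      (FF.continuousAt_eval _ (abs_pos.2 (sub_ne_zero.2 (ha i j h)))) hpair
  · simp only [edgeWeight, if_neg h]
    exact continuousAt_const

theorem continuous_weightLaplacian :
    Continuous (weightLaplacian : (Fin N → Fin N → ℝ) → Matrix (Fin N) (Fin N) ℝ) := by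
  unfold weightLaplacian
  have h : Continuous fun w : Fin N → Fin N → ℝ => fun i => ∑ j, w i j := by fun_prop
  exact h.matrix_diagonal.sub continuous_id

theorem continuousAt_weightLaplacian_edgeWeight (ω : G.edgeSet → FF) {a : Fin N → ℝ}
    (ha : ∀ i j, G.Adj i j → a i ≠ a j) :
    ContinuousAt (fun z : (G.edgeSet → FF) × (Fin N → ℝ) =>
      weightLaplacian (edgeWeight G (ensembleLaws z.1) z.2)) (ω, a) :=
  continuous_weightLaplacian.continuousAt.comp <|
    continuousAt_pi.2 fun i => continuousAt_pi.2 fun j => continuousAt_edgeWeight ω ha i j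

/-- The embedding of line coordinates into configurations. -/
def lineEmbedding : (Fin N → ℝ) →L[ℝ] (Fin N → ℝ × ℝ) :=
  ContinuousLinearMap.pi fun i => (ContinuousLinearMap.inl ℝ ℝ ℝ).comp
    (ContinuousLinearMap.proj (R := ℝ) (φ := fun _ : Fin N => ℝ) i)

/-- The differential of the potential restricted to a line and pinned at `r`. -/
theorem hasFDerivAt_pinnedPotential {f : Fin N → Fin N → ℝ → ℝ}
    (hf : ∀ i j, G.Adj i j → MemF (f i j)) {a : Fin N → ℝ}
    (ha : ∀ i j, G.Adj i j → a i ≠ a j) (r : Fin N) (x : ℝ) :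
    HasFDerivAt (fun b : Fin N → ℝ => potential G f (lineConfig b) + (b r - x) ^ 2 / 2)
      ((potentialDeriv G f (lineConfig a)).comp lineEmbedding +
        (a r - x) • ContinuousLinearMap.proj (R := ℝ) (φ := fun _ : Fin N => ℝ) r) a := by
  have h1 : HasFDerivAt (fun b : Fin N → ℝ => potential G f (lineConfig b))
      ((potentialDeriv G f (lineConfig a)).comp lineEmbedding) a :=
    HasFDerivAt.comp (g := potential G f) (f := fun b => lineEmbedding b) a
      (hasFDerivAt_potential hf ((inConfigSpace_lineConfig_iff a).2 ha)) lineEmbedding.hasFDerivAt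
  have h2 : HasDerivAt (fun y : ℝ => (y - x) ^ 2 / 2) (a r - x) (a r) := by
    refine ((((hasDerivAt_id (a r)).sub_const x).pow 2).div_const 2).congr_deriv ?_
    simp
  have h3 := h2.comp_hasFDerivAt a
    (ContinuousLinearMap.proj (R := ℝ) (φ := fun _ : Fin N => ℝ) r).hasFDerivAt
  exact h1.add h3

theorem pinnedPotential_deriv_apply {f : Fin N → Fin N → ℝ → ℝ} (hs : ∀ i j, f i j = f j i)
    (a v : Fin N → ℝ) (r : Fin N) (x : ℝ) :
    ((potentialDeriv G f (lineConfig a)).comp lineEmbedding +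
        (a r - x) • ContinuousLinearMap.proj (R := ℝ) (φ := fun _ : Fin N => ℝ) r) v =
      v ⬝ᵥ (weightLaplacian (edgeWeight G f a) *ᵥ a) + (a r - x) * v r := by
  rw [← potentialDeriv_lineConfig hs]
  rfl

theorem continuousAt_pinnedForm {ω : G.edgeSet → FF} (a : Fin N → ℝ) (r : Fin N)
    {b : Fin N → ℝ} (hb : ∀ i j, G.Adj i j → b i ≠ b j) :
    ContinuousAt (fun z : (G.edgeSet → FF) × (Fin N → ℝ) =>
      (z.2 - a) ⬝ᵥ (weightLaplacian (edgeWeight G (ensembleLaws z.1) z.2) *ᵥ z.2) +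
        (z.2 r - a r) ^ 2) (ω, b) := by
  have hL := continuousAt_weightLaplacian_edgeWeight ω hb
  have hc : Continuous fun y : Matrix (Fin N) (Fin N) ℝ × (Fin N → ℝ) =>
      (y.2 - a) ⬝ᵥ (y.1 *ᵥ y.2) + (y.2 r - a r) ^ 2 :=
    ((continuous_snd.sub continuous_const).dotProduct
      (continuous_fst.matrix_mulVec continuous_snd)).add
      ((((continuous_apply r).comp continuous_snd).sub continuous_const).pow 2)
  exact ContinuousAt.comp (f := fun z : (G.edgeSet → FF) × (Fin N → ℝ) =>
    (weightLaplacian (edgeWeight G (ensembleLaws z.1) z.2), z.2)) hc.continuousAt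
    (hL.prodMk continuousAt_snd)

/-- Line equilibria persist under perturbation of the interaction laws. -/
theorem eventually_exists_equilibrium {S : Fin N → Fin N → Prop} {ω : G.edgeSet → FF}
    {a : Fin N → ℝ} (ha : a ∈ sector G S)
    (heq : weightLaplacian (edgeWeight G (ensembleLaws ω) a) *ᵥ a = 0) {r : Fin N}
    (hconn : ∀ γ : Fin N → ℝ, (∀ i j, G.Adj i j → γ i = γ j) → ∀ i, γ i = γ r)
    {V : Set (Fin N → ℝ)} (hV : V ∈ 𝓝 a) :
    ∀ᶠ ω' in 𝓝 ω, ∃ b ∈ V, weightLaplacian (edgeWeight G (ensembleLaws ω') b) *ᵥ b = 0 := by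
  obtain ⟨ε, hε, hball⟩ := Metric.nhds_basis_closedBall.mem_iff.1
    (inter_mem hV ((isOpen_sector G S).mem_nhds ha))
  have hsphere : ∀ b ∈ Metric.sphere a ε, ∀ᶠ z : (G.edgeSet → FF) × (Fin N → ℝ) in 𝓝 (ω, b),
      0 < (z.2 - a) ⬝ᵥ (weightLaplacian (edgeWeight G (ensembleLaws z.1) z.2) *ᵥ z.2) +
        (z.2 r - a r) ^ 2 := by
    intro b hb
    have hbS := (hball (Metric.sphere_subset_closedBall hb)).2
    have hcont : ContinuousAt (fun z : (G.edgeSet → FF) × (Fin N → ℝ) =>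
        (z.2 - a) ⬝ᵥ (weightLaplacian (edgeWeight G (ensembleLaws z.1) z.2) *ᵥ z.2) +
          (z.2 r - a r) ^ 2) (ω, b) := by
      exact continuousAt_pinnedForm a r fun i j hij => (hbS i j hij).1
    refine hcont.eventually_const_lt ?_
    obtain ⟨hnn, hzero⟩ :=
      dotProduct_sub_nonneg (memF_ensembleLaws ω) (ensembleLaws_comm ω) hbS ha heq
    refine lt_of_le_of_ne (add_nonneg hnn (sq_nonneg _)) fun h => ?_
    have h0 : (b r - a r) ^ 2 = 0 := le_antisymm (by linarith) (sq_nonneg _)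
    have hr : b r - a r = 0 := by simpa using h0
    have hba : b = a := by
      ext i
      have : b i - a i = b r - a r :=
        hconn (fun i => b i - a i) (hzero (by linarith)) i
      linarith
    rw [hba, Metric.mem_sphere, dist_self] at hb
    exact hε.ne hb
  filter_upwards [(isCompact_sphere a ε).eventually_forall_of_forall_eventually
    (P := fun ω' b => 0 < (b - a) ⬝ᵥ
      (weightLaplacian (edgeWeight G (ensembleLaws ω') b) *ᵥ b) + (b r - a r) ^ 2) hsphere]
    with ω' hω'
  have hf := memF_ensembleLaws ω'
  have hs := ensembleLaws_comm ω'
  have hder := fun b (hb : b ∈ Metric.closedBall a ε) =>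
    hasFDerivAt_pinnedPotential hf (fun i j hij => ((hball hb).2 i j hij).1) r (a r)
  obtain ⟨b, hb, hmin⟩ := (isCompact_closedBall a ε).exists_isMinOn
    ⟨a, Metric.mem_closedBall_self hε.le⟩
    fun b hb => (hder b hb).continuousAt.continuousWithinAt
  refine ⟨b, (hball hb).1, ?_⟩
  have hlt : dist b a < ε := by
    refine lt_of_le_of_ne hb fun hdist => ?_
    have h1 := hmin.localize.hasFDerivWithinAt_nonneg (hder b hb).hasFDerivWithinAt
      (sub_mem_posTangentConeAt_of_segment_subset
        ((convex_closedBall a ε).segment_subset hb (Metric.mem_closedBall_self hε.le)))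
    rw [pinnedPotential_deriv_apply hs, ← neg_sub b a, neg_dotProduct, Pi.neg_apply,
      Pi.sub_apply] at h1
    have h2 := hω' b hdist
    nlinarith
  have hcrit := (hmin.isLocalMin (Metric.closedBall_mem_nhds_of_mem hlt)).hasFDerivAt_eq_zero
    (hder b hb)
  have hzero : ∀ v : Fin N → ℝ, v ⬝ᵥ (weightLaplacian (edgeWeight G (ensembleLaws ω') b) *ᵥ b) +
      (b r - a r) * v r = 0 := fun v => by
    rw [← pinnedPotential_deriv_apply hs, hcrit, _root_.zero_apply]
  have hr : b r - a r = 0 := by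
    have h1 := hzero fun _ => 1
    rw [weightLaplacian_dotProduct _ (edgeWeight_comm hs b)] at h1
    simpa using h1
  ext i
  have h1 := hzero (Pi.single i 1)
  rw [hr, zero_mul, add_zero, single_dotProduct, one_mul] at h1
  exact h1

end Ensemble

section Generic

variable {N : ℕ} {G : SimpleGraph (Fin N)}

/-- The weights of a line configuration can be moved in any direction by arbitrarily small
perturbations of the ensemble. -/
theorem eventually_exists_edgeWeight_eq (ω : G.edgeSet → FF) {O : Set (G.edgeSet → FF)}
    (hO : O ∈ 𝓝 ω) {a : Fin N → ℝ} (ha : ∀ i j, G.Adj i j → a i ≠ a j)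
    {v : Fin N → Fin N → ℝ} (hv : ∀ i j, v i j = v j i) (hv0 : ∀ i j, ¬ G.Adj i j → v i j = 0) :
    ∀ᶠ t : ℝ in 𝓝 0, ∃ ω' ∈ O, edgeWeight G (ensembleLaws ω') a =
      fun i j => edgeWeight G (ensembleLaws ω) a i j + t * v i j := by
  rw [nhds_pi, mem_pi'] at hO
  obtain ⟨I, T, hT, hsub⟩ := hO
  have hedge : ∀ e : G.edgeSet, ∀ᶠ t : ℝ in 𝓝 0, ∃ g ∈ T e, ∀ i j, s(i, j) = e.1 →
      g.1.1 |a i - a j| = (ω e).1.1 |a i - a j| + t * v i j := by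
    rintro ⟨e, he⟩
    induction e using Sym2.ind with
    | h i j =>
      filter_upwards [(ω ⟨s(i, j), he⟩).eventually_exists_perturbation (hT _)
        (abs_pos.2 (sub_ne_zero.2 (ha i j (G.mem_edgeSet.1 he)))) (v i j)] with t ht
      obtain ⟨g, hg, hgt⟩ := ht
      refine ⟨g, hg, fun k l hkl => ?_⟩
      rcases Sym2.eq_iff.1 hkl with ⟨rfl, rfl⟩ | ⟨rfl, rfl⟩
      · exact hgt
      · rw [abs_sub_comm, hv, hgt]
  filter_upwards [eventually_all.2 hedge] with t ht
  choose g hg hgt using ht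
  refine ⟨g, hsub fun e _ => hg e, ?_⟩
  ext i j
  by_cases h : G.Adj i j
  · simp only [edgeWeight, if_pos h, ensembleLaws_of_adj _ h]
    exact hgt _ i j rfl
  · simp [edgeWeight, h, hv0 i j h]

/-- The ensembles having a nondegenerate line equilibrium in a given sector. -/
def nondegenerateEnsembles (G : SimpleGraph (Fin N)) (S : Fin N → Fin N → Prop) (r s : Fin N) :
    Set (G.edgeSet → FF) :=
  {ω | ∃ a ∈ sector G S, weightLaplacian (edgeWeight G (ensembleLaws ω) a) *ᵥ a = 0 ∧
    (weightLaplacian (edgeWeight G (ensembleLaws ω) a) + markedDiag r s).det ≠ 0}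

theorem isOpen_nondegenerateEnsembles (S : Fin N → Fin N → Prop) {r : Fin N}
    (hconn : ∀ γ : Fin N → ℝ, (∀ i j, G.Adj i j → γ i = γ j) → ∀ i, γ i = γ r) (s : Fin N) :
    IsOpen (nondegenerateEnsembles G S r s) := by
  refine isOpen_iff_eventually.2 fun ω ⟨a, ha, heq, hdet⟩ => ?_
  have hL := continuousAt_weightLaplacian_edgeWeight ω fun i j hij => (ha i j hij).1
  have hdetc : Continuous fun M : Matrix (Fin N) (Fin N) ℝ => (M + markedDiag r s).det :=
    (continuous_id.add continuous_const).matrix_det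
  have hne : ∀ᶠ z : (G.edgeSet → FF) × (Fin N → ℝ) in 𝓝 (ω, a),
      (weightLaplacian (edgeWeight G (ensembleLaws z.1) z.2) + markedDiag r s).det ≠ 0 :=
    (ContinuousAt.comp (f := fun z : (G.edgeSet → FF) × (Fin N → ℝ) =>
      weightLaplacian (edgeWeight G (ensembleLaws z.1) z.2)) hdetc.continuousAt
      hL).eventually_ne hdet
  rw [nhds_prod_eq] at hne
  obtain ⟨P, hP, Q, hQ, hPQ⟩ := eventually_prod_iff.1 hne
  filter_upwards [hP, eventually_exists_equilibrium ha heq hconn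
    (inter_mem hQ ((isOpen_sector G S).mem_nhds ha))] with ω' hω' ⟨b, hb, hbeq⟩
  exact ⟨b, hb.2, hbeq, hPQ hω' hb.1⟩

theorem mem_closure_nondegenerateEnsembles {S : Fin N → Fin N → Prop} {r s : Fin N}
    (hrs : G.Adj r s)
    (hstress : ∀ a : Fin N → ℝ, (∀ i j, G.Adj i j → a i ≠ a j) →
      ∃ v : Fin N → Fin N → ℝ, (∀ i j, v i j = v j i) ∧ (∀ i j, ¬ G.Adj i j → v i j = 0) ∧
        weightLaplacian v *ᵥ a = 0 ∧
        ∀ β, weightLaplacian v *ᵥ β = 0 → β r = 0 → β s = 0 → β = 0)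
    {ω : G.edgeSet → FF} {a : Fin N → ℝ} (ha : a ∈ sector G S)
    (heq : weightLaplacian (edgeWeight G (ensembleLaws ω) a) *ᵥ a = 0) :
    ω ∈ closure (nondegenerateEnsembles G S r s) := by
  have hne : ∀ i j, G.Adj i j → a i ≠ a j := fun i j hij => (ha i j hij).1
  obtain ⟨v, hv, hv0, hva, hvnd⟩ := hstress a hne
  refine mem_closure_iff_nhds.2 fun O hO => ?_
  have hdet := eventually_det_ne_zero (edgeWeight_comm (ensembleLaws_comm ω) a) hv heq hva
    (hne r s hrs) hvnd
  obtain ⟨t, ⟨ω', hω', hw⟩, ht⟩ := ((eventually_exists_edgeWeight_eq ω hO hne hv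
    hv0).filter_mono nhdsWithin_le_nhds |>.and hdet).exists
  refine ⟨ω', hω', a, ha, ?_, by rwa [hw]⟩
  ext i
  have h1 := congrFun heq i
  have h2 := congrFun hva i
  rw [weightLaplacian_mulVec] at h1 h2
  rw [hw, weightLaplacian_mulVec]
  simp only [add_mul, mul_assoc, Finset.sum_add_distrib, ← Finset.mul_sum, h1, h2]
  simp

/-- Translating line coordinates does not change the weights. -/
theorem edgeWeight_congr_of_add_const {f : Fin N → Fin N → ℝ → ℝ} {a b : Fin N → ℝ} {x : ℝ}
    (h : ∀ i, a i = b i + x) : edgeWeight G f a = edgeWeight G f b := by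
  ext i j
  simp only [edgeWeight, h, add_sub_add_right_eq_sub]

theorem orientedLine_congr_of_add_const {c s vx vy x : ℝ} {a b : Fin N → ℝ}
    (h : ∀ i, a i = b i + x) :
    orientedLine c s vx vy a = orientedLine c s (vx + c * x) (vy + s * x) b := by
  ext i <;> simp only [orientedLine, h] <;> ring

/-- Line equilibria form finitely many orbits. -/
theorem exists_finite_representatives {f : Fin N → Fin N → ℝ → ℝ}
    (hf : ∀ i j, G.Adj i j → MemF (f i j)) (hs : ∀ i j, f i j = f j i) {r : Fin N}
    (hconn : ∀ γ : Fin N → ℝ, (∀ i j, G.Adj i j → γ i = γ j) → ∀ i, γ i = γ r) :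
    ∃ (k : ℕ) (reps : Fin k → (Fin N → ℝ × ℝ)), (∀ t, InConfigSpace G (reps t)) ∧
      {p | InConfigSpace G p ∧ IsEquilibrium G f p ∧ Collinear ℝ (range p)} =
        ⋃ t, {q | sameOrbit (reps t) q} := by
  let T := {S : Fin N → Fin N → Prop //
    ∃ a ∈ sector G S, weightLaplacian (edgeWeight G f a) *ᵥ a = 0}
  choose a ha haeq using fun S : T => S.2
  obtain ⟨k, ⟨e⟩⟩ := Finite.exists_equiv_fin T
  refine ⟨k, fun t => lineConfig (a (e.symm t)), fun t => ?_, ?_⟩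
  · exact (inConfigSpace_lineConfig_iff _).2 fun i j hij => (ha _ i j hij).1
  · ext p
    simp only [mem_iUnion, mem_ofPred_eq, sameOrbit_lineConfig_iff]
    constructor
    · rintro ⟨hconf, heq, hcol⟩
      obtain ⟨c, s, vx, vy, hcs, b, rfl⟩ := exists_orientedLine_of_collinear hcol
      have hb := (inConfigSpace_orientedLine_iff hcs b).1 hconf
      have hbeq := (isEquilibrium_orientedLine_iff hcs b).1 heq
      let S : T := ⟨fun i j => b i < b j, b, mem_sector_self hb, hbeq⟩
      refine ⟨e S, c, s, vx + c * (b r - a S r), vy + s * (b r - a S r), hcs, ?_⟩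
      rw [Equiv.symm_apply_apply]
      exact orientedLine_congr_of_add_const
        (sub_const_of_equilibria hf hs (mem_sector_self hb) (ha S) hbeq (haeq S) hconn)
    · rintro ⟨t, c, s, vx, vy, hcs, rfl⟩
      exact ⟨(inConfigSpace_orientedLine_iff hcs _).2 fun i j hij => (ha _ i j hij).1,
        (isEquilibrium_orientedLine_iff hcs _).2 (haeq _), collinear_orientedLine _⟩

end Generic

/-- for a TLG `G`, generically in the ensemble of interaction laws the
collection `K` of critical orbits of line configurations is finite and each such critical
orbit is nondegenerate (the Hessian of `Φ` there has exactly three zero eigenvalues). -/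
theorem statement5 {N : ℕ} (G : SimpleGraph (Fin N)) (hG : IsTLG G) :
    ∃ U : Set (G.edgeSet → FF), IsOpen U ∧ Dense U ∧
      ∀ ω ∈ U,
        (∃ (k : ℕ) (reps : Fin k → (Fin N → ℝ × ℝ)),
          (∀ t, InConfigSpace G (reps t)) ∧
          {p | InConfigSpace G p ∧ IsEquilibrium G (ensembleLaws ω) p ∧
              Collinear ℝ (Set.range p)}
            = ⋃ t, {q | sameOrbit (reps t) q}) ∧
        (∀ p : Fin N → ℝ × ℝ, InConfigSpace G p → IsEquilibrium G (ensembleLaws ω) p →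
          Collinear ℝ (Set.range p) →
          n0 (hessian (potential G (ensembleLaws ω)) p) = 3) := by
  obtain ⟨r, s, hrs, hconn, hstress⟩ := hG.exists_base_edge
  let D := fun S : Fin N → Fin N → Prop => nondegenerateEnsembles G S r s
  have hD : ∀ S, IsOpen (D S ∪ (closure (D S))ᶜ) := fun S =>
    (isOpen_nondegenerateEnsembles S hconn s).union isClosed_closure.isOpen_compl
  refine ⟨⋂ S, (D S ∪ (closure (D S))ᶜ), isOpen_iInter_of_finite hD,
    ?_, fun ω hω =>
    ⟨exists_finite_representatives (memF_ensembleLaws ω) (ensembleLaws_comm ω) hconn,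
      fun p hconf heq hcol => ?_⟩⟩
  · rw [← sInter_range]
    refine (finite_range _).dense_sInter (forall_mem_range.2 hD)
      (forall_mem_range.2 fun S x => ?_)
    rw [closure_union]
    exact (em (x ∈ closure (D S))).imp id fun h => subset_closure h
  · obtain ⟨c, s', vx, vy, hcs, a, rfl⟩ := exists_orientedLine_of_collinear hcol
    have ha := (inConfigSpace_orientedLine_iff hcs a).1 hconf
    have haeq := (isEquilibrium_orientedLine_iff hcs a).1 heq
    obtain ⟨b, hb, hbeq, hdet⟩ := (mem_iInter.1 hω fun i j => a i < a j).resolve_right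
      (not_not.2 (mem_closure_nondegenerateEnsembles hrs hstress (mem_sector_self ha) haeq))
    rw [← edgeWeight_congr_of_add_const (sub_const_of_equilibria (memF_ensembleLaws ω)
      (ensembleLaws_comm ω) (mem_sector_self ha) hb haeq hbeq hconn)] at hdet
    refine n0_hessian_orientedLine (memF_ensembleLaws ω) (ensembleLaws_comm ω) hcs ha haeq hrs
      hconn ((det_add_smul_markedDiag_ne_zero_iff (edgeWeight_comm (ensembleLaws_comm ω) a) haeq
        (ha r s hrs) one_ne_zero).1 ?_)
    rwa [one_smul]
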